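/- Let q > 1, let G₁, ..., G_k be pairwise nonisomorphic connected graphs each with at least two vertices, fix a positive irrational α, and let p = n^{−α}. Let I = {i ∈ [k] : m(G_i) < 1/α} and J = [k] \ I. Let ξ_i be the number of copies of G_i in G(n,p) reduced mod q. Then for every a ∈ (ℤ/qℤ)^k, Pr(ξ = a) → q^{−|I|} if a_j = 0 for all j ∈ J, and Pr(ξ = a) → 0 otherwise, as n → ∞. -/

import Mathlib

open Finset Filter
open scoped Classical

/-- Probability that `G(n,p)` equals a given graph `G` on `[n]`. -/
noncomputable def erWeight (n : ℕ) (p : ℝ) (G : SimpleGraph (Fin n)) : ℝ :=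
  p ^ G.edgeSet.ncard * (1 - p) ^ (n.choose 2 - G.edgeSet.ncard)

/-- The number of (unlabeled) copies of `H` in `G`. -/
noncomputable def copyCount {n : ℕ} (G : SimpleGraph (Fin n)) {W : Type*}
    (H : SimpleGraph W) : ℕ :=
  Set.ncard {S : G.Subgraph | Nonempty (S.coe ≃g H)}

/-! ### Product weights on subsets -/

/-- The weight of `S` as a `p`-random subset of `E`. -/
noncomputable def subsetWt {β : Type*} (E : Finset β) (p : ℝ) (S : Finset β) : ℝ :=
  p ^ #S * (1 - p) ^ (#E - #S)

lemma subsetWt_nonneg {β : Type*} (E : Finset β) {p : ℝ} (h0 : 0 ≤ p) (h1 : p ≤ 1)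
    (S : Finset β) : 0 ≤ subsetWt E p S := by
  unfold subsetWt
  have : 0 ≤ 1 - p := by linarith
  positivity

lemma sum_Icc_pow {β : Type*} [DecidableEq β] {R : Type*} [CommSemiring R] (a b : R)
    {A E : Finset β} (h : A ⊆ E) :
    ∑ T ∈ E.powerset with A ⊆ T, a ^ #T * b ^ (#E - #T) = a ^ #A * (a + b) ^ (#E - #A) := by
  have e1 : E.powerset.filter (fun T => A ⊆ T) = (E \ A).powerset.image (fun x => A ∪ x) := by
    rw [← Finset.Icc_eq_image_powerset h]
    ext T
    simp [and_comm]
  have hd : ∀ x ∈ (E \ A).powerset, Disjoint A x := by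
    intro x hx
    rw [mem_powerset] at hx
    exact (Finset.disjoint_sdiff).mono_right hx
  rw [e1, sum_image]
  · rw [← card_sdiff_of_subset h, ← sum_pow_mul_eq_add_pow, mul_sum]
    refine sum_congr rfl fun x hx => ?_
    have hc := card_union_of_disjoint (hd x hx)
    have hE := card_sdiff_of_subset h
    rw [hc, hE, pow_add, mul_assoc, Nat.sub_sub]
  · intro x hx y hy hxy
    have h1 := hd x hx
    have h2 := hd y hy
    simp only at hxy
    rw [← union_sdiff_cancel_left h1, hxy, union_sdiff_cancel_left h2]

lemma sum_subsetWt_superset {β : Type*} [DecidableEq β] (p : ℝ)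
    {A E : Finset β} (h : A ⊆ E) :
    ∑ T ∈ E.powerset with A ⊆ T, subsetWt E p T = p ^ #A := by
  unfold subsetWt
  rw [sum_Icc_pow _ _ h]
  simp

lemma sum_subsetWt {β : Type*} [DecidableEq β] (p : ℝ) (E : Finset β) :
    ∑ T ∈ E.powerset, subsetWt E p T = 1 := by
  have := sum_subsetWt_superset p (empty_subset E)
  simpa using this

/-- Thinning: a `p`-random subset is a uniformly random subset of a `2p`-random subset. -/
lemma thinning {β : Type*} [DecidableEq β] (E : Finset β) (p : ℝ) (F : Finset β → ℂ) :
    ∑ S ∈ E.powerset, (subsetWt E p S : ℂ) * F S =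
      ∑ T ∈ E.powerset, (subsetWt E (2 * p) T : ℂ) * ((1 / 2 : ℂ) ^ #T * ∑ S ∈ T.powerset, F S) := by
  have h1 : ∀ T ∈ E.powerset,
      (subsetWt E (2 * p) T : ℂ) * ((1 / 2 : ℂ) ^ #T * ∑ S ∈ T.powerset, F S) =
      ∑ S ∈ E.powerset, if S ⊆ T then ((p : ℂ) ^ #T * (1 - 2 * p) ^ (#E - #T)) * F S else 0 := by
    intro T hT
    rw [← sum_filter]
    have : E.powerset.filter (fun S => S ⊆ T) = T.powerset := by
      ext S
      simp only [mem_filter, mem_powerset] at *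
      exact ⟨fun h => h.2, fun h => ⟨h.trans hT, h⟩⟩
    rw [this, ← mul_sum, ← mul_assoc]
    congr 1
    unfold subsetWt
    push_cast
    rw [mul_pow]
    have : (2 : ℂ) ^ #T * (1 / 2) ^ #T = 1 := by rw [← mul_pow]; norm_num
    linear_combination ((p : ℂ) ^ #T * (1 - 2 * p) ^ (#E - #T)) * this
  rw [sum_congr rfl h1, sum_comm]
  refine sum_congr rfl fun S hS => ?_
  rw [← sum_filter, ← sum_mul, sum_Icc_pow _ _ (mem_powerset.1 hS)]
  unfold subsetWt
  push_cast
  congr 3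
  ring

/-! ### Iterated differences and the Cauchy-Schwarz (box norm) argument -/

/-- Iterated difference of a function of `d` variables. -/
def cubeDiff {A M : Type*} [AddCommGroup M] :
    (d : ℕ) → ((Fin d → A) → M) → (Fin d → A) → (Fin d → A) → M
  | 0, P, X, _ => P X
  | d + 1, P, X, X' =>
      cubeDiff d (fun y => P (Fin.cons (X 0) y) - P (Fin.cons (X' 0) y)) (Fin.tail X) (Fin.tail X')

lemma cubeDiff_sum {A M κ : Type*} [AddCommGroup M] (d : ℕ) (s : Finset κ)
    (P : κ → (Fin d → A) → M) (X X' : Fin d → A) :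
    cubeDiff d (fun Y => ∑ i ∈ s, P i Y) X X' = ∑ i ∈ s, cubeDiff d (P i) X X' := by
  induction d with
  | zero => simp [cubeDiff]
  | succ d ih =>
    simp only [cubeDiff]
    rw [← ih]
    congr 1
    funext y
    rw [sum_sub_distrib]

lemma cubeDiff_prod {A M : Type*} [CommRing M] (d : ℕ) (c : M) (g : Fin d → A → M)
    (X X' : Fin d → A) :
    cubeDiff d (fun Y => c * ∏ s, g s (Y s)) X X' = c * ∏ s, (g s (X s) - g s (X' s)) := by
  induction d generalizing c with
  | zero => simp [cubeDiff]
  | succ d ih =>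
    simp only [cubeDiff]
    have : (fun y : Fin d → A => c * ∏ s, g s (Fin.cons (α := fun _ => A) (X 0) y s)
        - c * ∏ s, g s (Fin.cons (α := fun _ => A) (X' 0) y s))
        = fun y => (c * (g 0 (X 0) - g 0 (X' 0))) * ∏ s, g (Fin.succ s) (y s) := by
      funext y
      simp only [Fin.prod_univ_succ, Fin.cons_zero, Fin.cons_succ]
      ring
    rw [this, ih, Fin.prod_univ_succ]
    simp only [Fin.tail]
    ring

/-- Boolean to ring element. -/
def bval {M : Type*} [Zero M] [One M] (b : Bool) : M := if b then 1 else 0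

/-- The per-block weights appearing in the bias bound. -/
noncomputable def blockW {q : ℕ} (χ : AddChar (ZMod q) ℂ) : ℕ → ZMod q → ℝ
  | 0, c => ‖(1 + χ c) / 2‖
  | d + 1, c => (2 * blockW χ d 0 + blockW χ d c + blockW χ d (-c)) / 4

lemma blockW_nonneg {q : ℕ} (χ : AddChar (ZMod q) ℂ) (d : ℕ) (c : ZMod q) :
    0 ≤ blockW χ d c := by
  induction d generalizing c with
  | zero => exact norm_nonneg _
  | succ d ih =>
    simp only [blockW]
    have h1 := ih 0
    have h2 := ih c
    have h3 := ih (-c)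
    linarith

lemma blockW_le_one {q : ℕ} [NeZero q] (χ : AddChar (ZMod q) ℂ) (d : ℕ) (c : ZMod q) :
    blockW χ d c ≤ 1 := by
  induction d generalizing c with
  | zero =>
    simp only [blockW]
    rw [norm_div]
    have := norm_add_le 1 (χ c)
    rw [AddChar.norm_apply] at this
    simp only [norm_one, Complex.norm_ofNat] at *
    linarith
  | succ d ih =>
    simp only [blockW]
    have h1 := ih 0
    have h2 := ih c
    have h3 := ih (-c)
    linarith

lemma blockW_lt_one {q : ℕ} [NeZero q] (χ : AddChar (ZMod q) ℂ) (hχ : ∀ c, c ≠ 0 → χ c ≠ 1)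
    (d : ℕ) (c : ZMod q) (hc : c ≠ 0) : blockW χ d c < 1 := by
  induction d generalizing c with
  | zero =>
    simp only [blockW]
    rw [norm_div]
    have hne : (1 : ℂ) ≠ χ c := fun h => hχ c hc h.symm
    have hn := AddChar.norm_apply χ c
    have : ‖(1 : ℂ) + χ c‖ < 2 := by
      have h := norm_add_lt_of_not_sameRay (x := (1 : ℂ)) (y := χ c) (by
        intro hs
        exact hne ((sameRay_iff_of_norm_eq (by simp [hn])).1 hs))
      rw [hn, norm_one] at h
      linarith
    simp only [Complex.norm_ofNat]
    linarith
  | succ d ih =>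
    simp only [blockW]
    have h1 := blockW_le_one χ d 0
    have h2 := ih c hc
    have h3 := blockW_le_one χ d (-c)
    linarith

lemma sum_fin_cons {A : Type*} [Fintype A] {M : Type*} [AddCommMonoid M] (d : ℕ)
    (f : (Fin (d + 1) → A) → M) :
    ∑ X, f X = ∑ y : Fin d → A, ∑ x : A, f (Fin.cons x y) := by
  rw [← (Fin.consEquiv (fun _ : Fin (d + 1) => A)).sum_comp, Fintype.sum_prod_type, sum_comm]
  rfl

lemma vdc_step {q : ℕ} [NeZero q] (χ : AddChar (ZMod q) ℂ) {A : Type*} [Fintype A] [Nonempty A]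
    (d : ℕ) (P : (Fin (d + 1) → A) → ZMod q) :
    (‖∑ X, χ (P X)‖ / (Fintype.card A : ℝ) ^ (d + 1)) ^ 2 ≤
      ∑ t : A × A, (1 / (Fintype.card A : ℝ) ^ 2) *
        (‖∑ y : Fin d → A, χ (P (Fin.cons t.1 y) - P (Fin.cons t.2 y))‖
          / (Fintype.card A : ℝ) ^ d) := by
  set N : ℝ := (Fintype.card A : ℝ) with hN
  have hNpos : 0 < N := by rw [hN]; exact_mod_cast Fintype.card_pos
  have key : ‖∑ X, χ (P X)‖ ^ 2 ≤
      N ^ d * ∑ t : A × A, ‖∑ y : Fin d → A, χ (P (Fin.cons t.1 y) - P (Fin.cons t.2 y))‖ := by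
    have h1 : ‖∑ X, χ (P X)‖ ≤ ∑ y : Fin d → A, ‖∑ x : A, χ (P (Fin.cons x y))‖ := by
      rw [sum_fin_cons]
      exact norm_sum_le _ _
    have h2 : (∑ y : Fin d → A, ‖∑ x : A, χ (P (Fin.cons x y))‖) ^ 2 ≤
        N ^ d * ∑ y : Fin d → A, ‖∑ x : A, χ (P (Fin.cons x y))‖ ^ 2 := by
      have := sq_sum_le_card_mul_sum_sq (s := (univ : Finset (Fin d → A)))
        (f := fun y => ‖∑ x : A, χ (P (Fin.cons x y))‖)
      simpa [hN] using this
    have h3 : (∑ y : Fin d → A, ‖∑ x : A, χ (P (Fin.cons x y))‖ ^ 2 : ℝ) ≤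
        ∑ t : A × A, ‖∑ y : Fin d → A, χ (P (Fin.cons t.1 y) - P (Fin.cons t.2 y))‖ := by
      have h4 : ((∑ y : Fin d → A, ‖∑ x : A, χ (P (Fin.cons x y))‖ ^ 2 : ℝ) : ℂ) =
          ∑ t : A × A, ∑ y : Fin d → A, χ (P (Fin.cons t.1 y) - P (Fin.cons t.2 y)) := by
        push_cast
        rw [sum_comm]
        refine sum_congr rfl fun y _ => ?_
        rw [← Complex.mul_conj', map_sum, sum_mul_sum, Fintype.sum_prod_type]
        refine sum_congr rfl fun x _ => sum_congr rfl fun x' _ => ?_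
        rw [← AddChar.map_neg_eq_conj, ← AddChar.map_add_eq_mul, sub_eq_add_neg]
      have h5 : 0 ≤ (∑ y : Fin d → A, ‖∑ x : A, χ (P (Fin.cons x y))‖ ^ 2 : ℝ) := by positivity
      calc (∑ y : Fin d → A, ‖∑ x : A, χ (P (Fin.cons x y))‖ ^ 2 : ℝ)
          = ‖((∑ y : Fin d → A, ‖∑ x : A, χ (P (Fin.cons x y))‖ ^ 2 : ℝ) : ℂ)‖ := by
            rw [Complex.norm_real, Real.norm_of_nonneg h5]
        _ ≤ _ := by rw [h4]; exact norm_sum_le _ _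
    calc ‖∑ X, χ (P X)‖ ^ 2 ≤ _ := pow_le_pow_left₀ (norm_nonneg _) h1 2
      _ ≤ _ := h2
      _ ≤ _ := mul_le_mul_of_nonneg_left h3 (by positivity)
  rw [← mul_sum, ← sum_div, div_pow]
  rw [div_le_iff₀ (by positivity)]
  refine key.trans (le_of_eq ?_)
  field_simp
  ring

lemma addChar_map_sum {q : ℕ} (χ : AddChar (ZMod q) ℂ) {κ : Type*} (s : Finset κ)
    (f : κ → ZMod q) : χ (∑ i ∈ s, f i) = ∏ i ∈ s, χ (f i) := by
  induction s using Finset.induction_on with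
  | empty => simp
  | insert a s ha ih => rw [sum_insert ha, prod_insert ha, AddChar.map_add_eq_mul, ih]

lemma bias_bound {q : ℕ} [NeZero q] (χ : AddChar (ZMod q) ℂ) {R : Type*} [Fintype R]
    (d : ℕ) (c : R → ZMod q) (P : (Fin (d + 1) → (R → Bool)) → ZMod q)
    (hP : ∀ X X', cubeDiff (d + 1) P X X' =
      ∑ j, c j * ∏ s, (bval (X s j) - bval (X' s j))) :
    (‖∑ X, χ (P X)‖ / (Fintype.card (R → Bool) : ℝ) ^ (d + 1)) ^ (2 ^ d) ≤
      ∏ j, blockW χ d (c j) := by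
  induction d generalizing c with
  | zero =>
    have h1 : ∀ x : R → Bool, ∀ y : Fin 0 → (R → Bool), P (Fin.cons x y) =
        P (fun _ _ => false) + ∑ j, c j * bval (x j) := by
      intro x y
      have := hP (Fin.cons x y) (fun _ _ => false)
      simp only [cubeDiff, Fin.cons_zero, Fin.tail_cons, Fin.prod_univ_succ] at this
      simp only [bval, Bool.false_eq_true, if_false, sub_zero, univ_eq_empty, prod_empty,
        mul_one] at this
      have h2 : (Fin.cons (fun _ => false) y : Fin 1 → R → Bool) = fun _ _ => false := by
        funext i
        fin_cases i
        rfl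
      rw [h2] at this
      simp only [bval]
      rw [← this]
      ring
    have h3 : ∑ X, χ (P X) = χ (P (fun _ _ => false)) * ∏ j, (1 + χ (c j)) := by
      rw [sum_fin_cons]
      simp only [h1]
      simp only [univ_unique, sum_singleton, AddChar.map_add_eq_mul, ← mul_sum]
      congr 1
      have : ∀ j, (1 + χ (c j)) = ∑ b : Bool, χ (c j * bval b) := by
        intro j
        simp [bval, add_comm]
      simp only [this]
      rw [Fintype.prod_sum]
      refine sum_congr rfl fun x _ => ?_
      exact addChar_map_sum χ _ _
    rw [h3, norm_mul, AddChar.norm_apply, norm_prod]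
    simp only [blockW, pow_zero, pow_one, one_mul, zero_add, norm_div, prod_div_distrib]
    simp
  | succ d ih =>
    set N : ℝ := (Fintype.card (R → Bool) : ℝ) with hN
    have hNpos : 0 < N := by rw [hN]; exact_mod_cast Fintype.card_pos
    have hstep := vdc_step χ (d + 1) P
    rw [← hN] at hstep
    have hw : ∑ t : (R → Bool) × (R → Bool), (1 / N ^ 2) = 1 := by
      simp only [sum_const, card_univ, Fintype.card_prod, nsmul_eq_mul, Nat.cast_mul, ← hN]
      field_simp
    have hJ := Real.pow_arith_mean_le_arith_mean_pow univ
      (fun _ : (R → Bool) × (R → Bool) => 1 / N ^ 2)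
      (fun t => ‖∑ y : Fin (d + 1) → (R → Bool), χ (P (Fin.cons t.1 y) - P (Fin.cons t.2 y))‖
          / N ^ (d + 1)) (fun _ _ => by positivity) hw (fun _ _ => by positivity) (2 ^ d)
    rw [pow_succ 2 d, mul_comm (2 ^ d) 2, pow_mul]
    refine (pow_le_pow_left₀ (by positivity) hstep _).trans (hJ.trans ?_)
    have hI : ∀ t : (R → Bool) × (R → Bool),
        (‖∑ y : Fin (d + 1) → (R → Bool), χ (P (Fin.cons t.1 y) - P (Fin.cons t.2 y))‖
          / N ^ (d + 1)) ^ 2 ^ d ≤ ∏ j, blockW χ d (c j * (bval (t.1 j) - bval (t.2 j))) := by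
      intro t
      refine ih (fun j => c j * (bval (t.1 j) - bval (t.2 j)))
        (fun y => P (Fin.cons t.1 y) - P (Fin.cons t.2 y)) ?_
      intro Y Y'
      have := hP (Fin.cons t.1 Y) (Fin.cons t.2 Y')
      rw [cubeDiff] at this
      simp only [Fin.cons_zero, Fin.tail_cons] at this
      rw [this]
      refine sum_congr rfl fun j _ => ?_
      rw [Fin.prod_univ_succ]
      simp only [Fin.cons_zero, Fin.cons_succ]
      ring
    refine (sum_le_sum fun t _ => mul_le_mul_of_nonneg_left (hI t) (by positivity)).trans ?_
    rw [← (Equiv.arrowProdEquivProdArrow R (fun _ => Bool) (fun _ => Bool)).sum_comp]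
    have hcard : (1 / N ^ 2) = ∏ _j : R, (1 / 4 : ℝ) := by
      rw [hN]
      simp only [Fintype.card_fun, Fintype.card_bool, prod_const, card_univ]
      push_cast
      rw [← pow_mul, mul_comm, pow_mul, one_div_pow]
      norm_num
    rw [hcard]
    simp only [← prod_mul_distrib]
    refine le_of_eq ?_
    have hb : ∀ j, blockW χ (d + 1) (c j) = ∑ t : Bool × Bool,
        1 / 4 * blockW χ d (c j * (bval t.1 - bval t.2)) := by
      intro j
      simp only [Fintype.sum_prod_type, Fintype.sum_bool, blockW, bval]
      simp
      ring
    simp only [hb]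
    rw [Fintype.prod_sum]
    rfl

/-! ### Copies as edge sets -/

/-- Edge sets of the copies of `H` in the complete graph on `Fin n`. -/
noncomputable def copyEdges (n : ℕ) {v : ℕ} (H : SimpleGraph (Fin v)) :
    Finset (Finset (Sym2 (Fin n))) :=
  univ.image (fun φ : Fin v ↪ Fin n => H.edgeFinset.image (Sym2.map φ))

/-- Number of copies of `H` with all edges in `S`. -/
noncomputable def copyNum (n : ℕ) {v : ℕ} (H : SimpleGraph (Fin v))
    (S : Finset (Sym2 (Fin n))) : ℕ :=
  #((copyEdges n H).filter (· ⊆ S))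

lemma exists_adj_of_connected {v : ℕ} (hv : 2 ≤ v) {H : SimpleGraph (Fin v)} (hH : H.Connected)
    (x : Fin v) : ∃ y, H.Adj x y := by
  have : Nontrivial (Fin v) := Fin.nontrivial_iff_two_le.2 hv
  exact hH.preconnected.exists_adj_of_nontrivial x

lemma copyCount_eq {n v : ℕ} (hv : 2 ≤ v) (H : SimpleGraph (Fin v)) (hH : H.Connected)
    (G : SimpleGraph (Fin n)) : copyCount G H = copyNum n H G.edgeFinset := by
  unfold copyCount copyNum
  have h0 : {S : G.Subgraph | Nonempty (S.coe ≃g H)} =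
      Set.range (SimpleGraph.Copy.toSubgraph (A := H) (B := G)) := by
    rw [SimpleGraph.Copy.range_toSubgraph]
    ext S
    exact ⟨fun ⟨f⟩ => ⟨f.symm⟩, fun ⟨f⟩ => ⟨f.symm⟩⟩
  rw [h0]
  have hes : ∀ f : SimpleGraph.Copy H G, f.toSubgraph.edgeSet = Sym2.map f '' H.edgeSet := by
    intro f
    rw [SimpleGraph.Copy.toSubgraph, SimpleGraph.Subgraph.edgeSet_map]
    rw [SimpleGraph.Subgraph.edgeSet_top]
    rfl
  have hinj : Set.InjOn (fun S : G.Subgraph => S.edgeSet)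
      (Set.range (SimpleGraph.Copy.toSubgraph (A := H) (B := G))) := by
    rintro _ ⟨f, rfl⟩ _ ⟨g, rfl⟩ hfg
    simp only at hfg
    have hadj : ∀ a b, f.toSubgraph.Adj a b ↔ g.toSubgraph.Adj a b := by
      intro a b
      rw [← SimpleGraph.Subgraph.mem_edgeSet, hfg, SimpleGraph.Subgraph.mem_edgeSet]
    have hvert : ∀ f g : SimpleGraph.Copy H G,
        (∀ a b, f.toSubgraph.Adj a b ↔ g.toSubgraph.Adj a b) →
        f.toSubgraph.verts ⊆ g.toSubgraph.verts := by
      intro f g hadj z hz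
      simp only [SimpleGraph.Copy.toSubgraph, SimpleGraph.Subgraph.map_verts] at hz
      obtain ⟨x, -, rfl⟩ := hz
      obtain ⟨y, hy⟩ := exists_adj_of_connected hv hH x
      have : f.toSubgraph.Adj (f.toHom x) (f.toHom y) := by
        rw [SimpleGraph.Copy.toSubgraph]
        exact ⟨x, y, hy, rfl, rfl⟩
      exact ((hadj _ _).1 this).fst_mem
    exact SimpleGraph.Subgraph.ext
      (Set.Subset.antisymm (hvert f g hadj) (hvert g f fun a b => (hadj a b).symm))
      (by funext a b; exact propext (hadj a b))
  rw [← Set.InjOn.ncard_image hinj]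
  have himg : (fun S : G.Subgraph => S.edgeSet) ''
      (Set.range (SimpleGraph.Copy.toSubgraph (A := H) (B := G))) =
      (fun K : Finset (Sym2 (Fin n)) => (K : Set (Sym2 (Fin n)))) ''
        (((copyEdges n H).filter (· ⊆ G.edgeFinset) : Finset (Finset (Sym2 (Fin n)))) :
          Set (Finset (Sym2 (Fin n)))) := by
    ext s
    constructor
    · rintro ⟨_, ⟨f, rfl⟩, rfl⟩
      refine ⟨H.edgeFinset.image (Sym2.map f), ?_, ?_⟩
      · simp only [coe_filter, Set.mem_ofPred_eq, copyEdges, mem_image, mem_univ, true_and]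
        refine ⟨⟨f.toEmbedding, rfl⟩, ?_⟩
        intro e he
        rw [mem_image] at he
        obtain ⟨e', he', rfl⟩ := he
        rw [SimpleGraph.mem_edgeFinset] at *
        exact f.toHom.map_mem_edgeSet he'
      · simp only [coe_image, SimpleGraph.coe_edgeFinset]
        rw [hes]
    · rintro ⟨K, hK, rfl⟩
      simp only [coe_filter, Set.mem_ofPred_eq, copyEdges, mem_image, mem_univ, true_and] at hK
      obtain ⟨⟨φ, rfl⟩, hK⟩ := hK
      have hhom : ∀ {a b}, H.Adj a b → G.Adj (φ a) (φ b) := by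
        intro a b hab
        have : Sym2.map φ s(a, b) ∈ G.edgeFinset :=
          hK (mem_image_of_mem _ (SimpleGraph.mem_edgeFinset.2 hab))
        rw [SimpleGraph.mem_edgeFinset] at this
        simpa using this
      let f : SimpleGraph.Copy H G := ⟨⟨φ, hhom⟩, φ.injective⟩
      refine ⟨f.toSubgraph, ⟨f, rfl⟩, ?_⟩
      simp only [coe_image, SimpleGraph.coe_edgeFinset]
      rw [hes]
      rfl
  rw [himg, Set.ncard_image_of_injective _ Finset.coe_injective, Set.ncard_coe_finset]

/-- Two connected graphs having a common edge-image are isomorphic. -/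
lemma iso_of_image_eq {n v w : ℕ} (hv : 2 ≤ v) (hw : 2 ≤ w) (H : SimpleGraph (Fin v))
    (H' : SimpleGraph (Fin w)) (hH : H.Connected) (hH' : H'.Connected)
    (φ : Fin v ↪ Fin n) (ψ : Fin w ↪ Fin n)
    (h : H.edgeFinset.image (Sym2.map φ) = H'.edgeFinset.image (Sym2.map ψ)) :
    Nonempty (H ≃g H') := by
  have aux : ∀ {v w : ℕ} (H : SimpleGraph (Fin v)) (H' : SimpleGraph (Fin w))
      (φ : Fin v ↪ Fin n) (ψ : Fin w ↪ Fin n),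
      H.edgeFinset.image (Sym2.map φ) = H'.edgeFinset.image (Sym2.map ψ) →
      ∀ x y, H.Adj x y → ∃ a b, H'.Adj a b ∧ ψ a = φ x ∧ ψ b = φ y := by
    intro v w H H' φ ψ h x y hxy
    have h1 : Sym2.map φ s(x, y) ∈ H'.edgeFinset.image (Sym2.map ψ) := by
      rw [← h]
      exact mem_image_of_mem _ (SimpleGraph.mem_edgeFinset.2 hxy)
    rw [mem_image] at h1
    obtain ⟨e, he, hee⟩ := h1
    induction e using Sym2.ind with
    | _ a b =>
      rw [SimpleGraph.mem_edgeFinset, SimpleGraph.mem_edgeSet] at he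
      simp only [Sym2.map_mk, Sym2.eq_iff] at hee
      rcases hee with ⟨h1, h2⟩ | ⟨h1, h2⟩
      · exact ⟨a, b, he, h1, h2⟩
      · exact ⟨b, a, he.symm, h2, h1⟩
  have a1 := aux H H' φ ψ h
  have a2 := aux H' H ψ φ h.symm
  have e1 : ∀ x, ∃ a, ψ a = φ x := fun x => by
    obtain ⟨y, hy⟩ := exists_adj_of_connected hv hH x
    obtain ⟨a, b, -, h, -⟩ := a1 x y hy
    exact ⟨a, h⟩
  have e2 : ∀ x, ∃ a, φ a = ψ x := fun x => by
    obtain ⟨y, hy⟩ := exists_adj_of_connected hw hH' x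
    obtain ⟨a, b, -, h, -⟩ := a2 x y hy
    exact ⟨a, h⟩
  choose f hf using e1
  choose g hg using e2
  refine ⟨⟨⟨f, g, fun x => φ.injective (by rw [hg, hf]), fun x => ψ.injective (by rw [hf, hg])⟩, ?_⟩⟩
  intro x y
  simp only [Equiv.coe_fn_mk]
  constructor
  · intro hxy
    obtain ⟨a, b, hab, h1, h2⟩ := a2 _ _ hxy
    rw [hf] at h1 h2
    rwa [← φ.injective h1, ← φ.injective h2]
  · intro hxy
    obtain ⟨a, b, hab, h1, h2⟩ := a1 _ _ hxy
    rw [← hf] at h1 h2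
    rwa [← ψ.injective h1, ← ψ.injective h2]

/-! ### Blocks of variables -/

section Blocks

/-- The set of selected block variables. -/
noncomputable def selSet {β : Type*} [DecidableEq β] {R : Type*} [Fintype R] {d : ℕ}
    (e : Fin d → R → β) (X : Fin d → R → Bool) : Finset β :=
  (univ.filter (fun t : Fin d × R => X t.1 t.2 = true)).image (fun t => e t.1 t.2)

/-- All block variables. -/
noncomputable def blockSet {β : Type*} [DecidableEq β] {R : Type*} [Fintype R] {d : ℕ}
    (e : Fin d → R → β) : Finset β :=
  univ.image (fun t : Fin d × R => e t.1 t.2)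

variable {β : Type*} [DecidableEq β] {R : Type*} [Fintype R] {d : ℕ}

lemma mem_selSet (e : Fin d → R → β) (X : Fin d → R → Bool) (b : β) :
    b ∈ selSet e X ↔ ∃ s j, X s j = true ∧ e s j = b := by
  simp [selSet]

lemma mem_blockSet (e : Fin d → R → β) (b : β) :
    b ∈ blockSet e ↔ ∃ s j, e s j = b := by
  simp [blockSet]

lemma mem_selSet_apply (e : Fin d → R → β) (he : ∀ s j s' j', e s j = e s' j' → s = s' ∧ j = j')
    (X : Fin d → R → Bool) (s : Fin d) (j : R) :
    e s j ∈ selSet e X ↔ X s j = true := by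
  rw [mem_selSet]
  constructor
  · rintro ⟨s', j', h, h'⟩
    obtain ⟨rfl, rfl⟩ := he _ _ _ _ h'
    exact h
  · intro h
    exact ⟨s, j, h, rfl⟩

lemma card_blockSet (e : Fin d → R → β)
    (he : ∀ s j s' j', e s j = e s' j' → s = s' ∧ j = j') :
    #(blockSet e) = d * Fintype.card R := by
  unfold blockSet
  rw [card_image_of_injective]
  · simp
  · rintro ⟨s, j⟩ ⟨s', j'⟩ h
    obtain ⟨rfl, rfl⟩ := he _ _ _ _ h
    rfl

/-- The factor of the monomial of `K` in group `s`. -/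
noncomputable def groupFac {M : Type*} [CommRing M] (e : Fin d → R → β) (K : Finset β)
    (s : Fin d) (x : R → Bool) : M :=
  ∏ j, (if e s j ∈ K then bval (x j) else 1)

lemma indicator_eq {M : Type*} [CommRing M] (e : Fin d → R → β)
    (he : ∀ s j s' j', e s j = e s' j' → s = s' ∧ j = j') (K S0 : Finset β)
    (hS0 : Disjoint S0 (blockSet e)) (X : Fin d → R → Bool) :
    (if K ⊆ S0 ∪ selSet e X then (1 : M) else 0) =
      (if K \ blockSet e ⊆ S0 then 1 else 0) * ∏ s, groupFac e K s (X s) := by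
  by_cases h : K ⊆ S0 ∪ selSet e X
  · have h1 : K \ blockSet e ⊆ S0 := by
      intro b hb
      rw [Finset.mem_sdiff] at hb
      rcases mem_union.1 (h hb.1) with h2 | h2
      · exact h2
      · rw [mem_selSet] at h2
        obtain ⟨s, j, -, h3⟩ := h2
        exact absurd ((mem_blockSet e b).2 ⟨s, j, h3⟩) hb.2
    rw [if_pos h, if_pos h1, one_mul]
    symm
    refine prod_eq_one fun s _ => prod_eq_one fun j _ => ?_
    split_ifs with h2
    · rcases mem_union.1 (h h2) with h3 | h3
      · exact absurd ((mem_blockSet e _).2 ⟨s, j, rfl⟩) (disjoint_left.1 hS0 h3)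
      · rw [mem_selSet_apply e he] at h3
        simp [bval, h3]
    · rfl
  · rw [if_neg h]
    split_ifs with h1
    · rw [not_subset] at h
      obtain ⟨b, hbK, hb⟩ := h
      rw [mem_union, not_or] at hb
      have hbU : b ∈ blockSet e := by
        by_contra h2
        exact hb.1 (h1 (Finset.mem_sdiff.2 ⟨hbK, h2⟩))
      rw [mem_blockSet] at hbU
      obtain ⟨s, j, rfl⟩ := hbU
      rw [mem_selSet_apply e he] at hb
      rw [one_mul]
      symm
      refine prod_eq_zero (mem_univ s) (prod_eq_zero (mem_univ j) ?_)
      rw [if_pos hbK]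
      simp [bval, hb.2]
    · simp

lemma exists_transversal {M : Type*} [CommRing M] (e : Fin d → R → β)
    (he : ∀ s j s' j', e s j = e s' j' → s = s' ∧ j = j') (K : Finset β) (hK : #K ≤ d)
    (X X' : Fin d → R → Bool)
    (h : ∏ s, ((groupFac e K s (X s) : M) - groupFac e K s (X' s)) ≠ 0) :
    ∃ j : Fin d → R, K = univ.image (fun s => e s (j s)) := by
  have h1 : ∀ s, ∃ j, e s j ∈ K := by
    intro s
    by_contra hne
    push Not at hne
    refine h (prod_eq_zero (mem_univ s) ?_)
    simp [groupFac, hne]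
  choose j hj using h1
  refine ⟨j, ?_⟩
  symm
  apply eq_of_subset_of_card_le
  · intro b hb
    rw [mem_image] at hb
    obtain ⟨s, -, rfl⟩ := hb
    exact hj s
  · rw [card_image_of_injective]
    · simpa using hK
    · intro s s' hs
      exact (he _ _ _ _ hs).1

lemma term_of_block {M : Type*} [CommRing M] (e : Fin d → R → β)
    (he : ∀ s j s' j', e s j = e s' j' → s = s' ∧ j = j') (S0 : Finset β) (j : R)
    (X X' : Fin d → R → Bool) :
    (if (univ.image (fun s => e s j)) \ blockSet e ⊆ S0 then (1 : M) else 0) *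
      ∏ s, ((groupFac e (univ.image (fun s => e s j)) s (X s) : M) -
        groupFac e (univ.image (fun s => e s j)) s (X' s)) =
      ∏ s, (bval (X s j) - bval (X' s j)) := by
  have h1 : (univ.image (fun s => e s j)) \ blockSet e ⊆ S0 := by
    intro b hb
    rw [Finset.mem_sdiff, mem_image] at hb
    obtain ⟨⟨s, -, rfl⟩, hb⟩ := hb
    exact absurd ((mem_blockSet e _).2 ⟨s, j, rfl⟩) hb
  have h2 : ∀ s (x : R → Bool),
      (groupFac e (univ.image (fun s => e s j)) s x : M) = bval (x j) := by
    intro s x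
    unfold groupFac
    rw [prod_eq_single j]
    · rw [if_pos (mem_image_of_mem _ (mem_univ s))]
    · intro j' _ hj'
      rw [if_neg]
      intro hm
      rw [mem_image] at hm
      obtain ⟨s', -, h⟩ := hm
      exact hj' (he _ _ _ _ h).2.symm
    · simp
  rw [if_pos h1, one_mul]
  simp only [h2]

lemma sum_powerset_split (e : Fin d → R → β)
    (he : ∀ s j s' j', e s j = e s' j' → s = s' ∧ j = j') (T : Finset β)
    (hT : blockSet e ⊆ T) (F : Finset β → ℂ) :
    ∑ S ∈ T.powerset, F S =
      ∑ S0 ∈ (T \ blockSet e).powerset, ∑ X : Fin d → R → Bool, F (S0 ∪ selSet e X) := by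
  rw [← sum_product']
  symm
  refine sum_bij' (fun t _ => t.1 ∪ selSet e t.2)
    (fun S _ => (S \ blockSet e, fun s j => decide (e s j ∈ S))) ?_ ?_ ?_ ?_ ?_
  · rintro ⟨S0, X⟩ h
    simp only [mem_product, mem_powerset, mem_univ, and_true] at h ⊢
    refine union_subset (h.trans sdiff_subset) ?_
    refine subset_trans ?_ hT
    intro b hb
    rw [mem_selSet] at hb
    obtain ⟨s, j, -, rfl⟩ := hb
    exact (mem_blockSet e _).2 ⟨s, j, rfl⟩
  · intro S hS
    simp only [mem_product, mem_powerset, mem_univ, and_true] at hS ⊢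
    exact sdiff_subset_sdiff hS (le_refl _)
  · rintro ⟨S0, X⟩ h
    simp only [mem_product, mem_powerset, mem_univ, and_true] at h
    have hS0 : ∀ b ∈ S0, b ∉ blockSet e := fun b hb => (Finset.mem_sdiff.1 (h hb)).2
    simp only [Prod.mk.injEq]
    constructor
    · ext b
      simp only [Finset.mem_sdiff, mem_union]
      constructor
      · rintro ⟨h1 | h1, h2⟩
        · exact h1
        · rw [mem_selSet] at h1
          obtain ⟨s, j, -, rfl⟩ := h1
          exact absurd ((mem_blockSet e _).2 ⟨s, j, rfl⟩) h2
      · intro hb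
        exact ⟨Or.inl hb, hS0 b hb⟩
    · funext s j
      have h1 : e s j ∉ S0 := fun hb => hS0 _ hb ((mem_blockSet e _).2 ⟨s, j, rfl⟩)
      simp only [mem_union, h1, false_or, mem_selSet_apply e he]
      simp
  · intro S hS
    ext b
    simp only [mem_union, Finset.mem_sdiff, mem_selSet, decide_eq_true_eq]
    constructor
    · rintro (h | ⟨s, j, h, rfl⟩)
      · exact h.1
      · exact h
    · intro h
      by_cases hb : b ∈ blockSet e
      · obtain ⟨s, j, rfl⟩ := (mem_blockSet e b).1 hb
        exact Or.inr ⟨s, j, h, rfl⟩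
      · exact Or.inl ⟨h, hb⟩
  · intro t _
    rfl

lemma avg_le_of_blocks (e : Fin d → R → β)
    (he : ∀ s j s' j', e s j = e s' j' → s = s' ∧ j = j') (T : Finset β)
    (hT : blockSet e ⊆ T) (F : Finset β → ℂ) (δ : ℝ)
    (h : ∀ S0, Disjoint S0 (blockSet e) →
      ‖∑ X : Fin d → R → Bool, F (S0 ∪ selSet e X)‖ / (Fintype.card (R → Bool) : ℝ) ^ d ≤ δ) :
    ‖(1 / 2 : ℂ) ^ #T * ∑ S ∈ T.powerset, F S‖ ≤ δ := by
  have hN : (Fintype.card (R → Bool) : ℝ) ^ d = 2 ^ #(blockSet e) := by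
    rw [card_blockSet e he]
    simp only [Fintype.card_fun, Fintype.card_bool]
    push_cast
    rw [← pow_mul, mul_comm]
  have h1 : ‖∑ S ∈ T.powerset, F S‖ ≤ 2 ^ #T * δ := by
    rw [sum_powerset_split e he T hT]
    refine (norm_sum_le _ _).trans ?_
    have h2 : ∀ S0 ∈ (T \ blockSet e).powerset,
        ‖∑ X : Fin d → R → Bool, F (S0 ∪ selSet e X)‖ ≤ 2 ^ #(blockSet e) * δ := by
      intro S0 hS0
      rw [mem_powerset] at hS0
      have h3 := h S0 (Finset.disjoint_of_subset_left hS0 sdiff_disjoint)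
      rw [hN, div_le_iff₀ (by positivity)] at h3
      linarith
    refine (sum_le_sum h2).trans (le_of_eq ?_)
    rw [sum_const, card_powerset, nsmul_eq_mul, card_sdiff_of_subset hT]
    push_cast
    rw [← mul_assoc, ← pow_add, Nat.sub_add_cancel (card_le_card hT)]
  rw [norm_mul, norm_pow]
  simp only [one_div, norm_inv, Complex.norm_ofNat, inv_pow]
  rw [inv_mul_le_iff₀ (by positivity)]
  exact h1

end Blocks

lemma block_eq_of_transversal {n v w r d : ℕ}
    (H' : SimpleGraph (Fin w)) (hH' : H'.Connected)
    (ε : Fin (d + 1) → Sym2 (Fin v))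
    (φ : Fin r × Fin v ↪ Fin n) (ψ : Fin w ↪ Fin n) (j : Fin (d + 1) → Fin r)
    (h : H'.edgeFinset.image (Sym2.map ψ) =
      univ.image (fun s => Sym2.map (fun x => φ (j s, x)) (ε s))) :
    ∀ s, j s = j 0 := by
  have key : ∀ x y, H'.Adj x y → ∃ s u u', ψ x = φ (j s, u) ∧ ψ y = φ (j s, u') := by
    intro x y hxy
    have h1 : Sym2.map ψ s(x, y) ∈ H'.edgeFinset.image (Sym2.map ψ) :=
      mem_image_of_mem _ (SimpleGraph.mem_edgeFinset.2 hxy)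
    rw [h, mem_image] at h1
    obtain ⟨s, -, hs⟩ := h1
    generalize ε s = a at hs
    induction a using Sym2.ind with
    | _ u u' =>
      simp only [Sym2.map_mk, Sym2.eq_iff] at hs
      rcases hs with ⟨h1, h2⟩ | ⟨h1, h2⟩
      · exact ⟨s, u, u', h1.symm, h2.symm⟩
      · exact ⟨s, u', u, h2.symm, h1.symm⟩
  have rev : ∀ s, ∃ x u, ψ x = φ (j s, u) := by
    intro s
    have h1 : Sym2.map (fun x => φ (j s, x)) (ε s) ∈ H'.edgeFinset.image (Sym2.map ψ) := by
      rw [h]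
      exact mem_image_of_mem _ (mem_univ s)
    rw [mem_image] at h1
    obtain ⟨b, -, hs⟩ := h1
    generalize ε s = a at hs
    induction a using Sym2.ind with
    | _ u u' =>
      induction b using Sym2.ind with
      | _ x y =>
        simp only [Sym2.map_mk, Sym2.eq_iff] at hs
        rcases hs with ⟨h1, h2⟩ | ⟨h1, h2⟩
        · exact ⟨x, u, h1⟩
        · exact ⟨x, u', h1⟩
  obtain ⟨x0, u0, hx0⟩ := rev 0
  have hall : ∀ x, ∃ u, ψ x = φ (j 0, u) := by
    intro x
    obtain ⟨p⟩ := hH'.preconnected x x0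
    induction p with
    | nil => exact ⟨u0, hx0⟩
    | cons hadj p ih =>
      obtain ⟨u, hu⟩ := ih hx0
      obtain ⟨s, a, b, ha, hb⟩ := key _ _ hadj
      have h1 := φ.injective (hb.symm.trans hu)
      rw [Prod.mk.injEq] at h1
      exact ⟨a, by rw [ha, h1.1]⟩
  intro s
  obtain ⟨x, u, hx⟩ := rev s
  obtain ⟨u', hu'⟩ := hall x
  have h1 := φ.injective (hx.symm.trans hu')
  rw [Prod.mk.injEq] at h1
  exact h1.1

/-- The key conditional bias estimate. -/
lemma avg_char_le {q : ℕ} [NeZero q] (χ : AddChar (ZMod q) ℂ) {ι : Type*} [Fintype ι]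
    (nv : ι → ℕ) (h2 : ∀ i, 2 ≤ nv i) (G : ∀ i, SimpleGraph (Fin (nv i)))
    (hconn : ∀ i, (G i).Connected) (hnoniso : ∀ i j, i ≠ j → IsEmpty ((G i) ≃g (G j)))
    (c : ι → ZMod q) (i0 : ι) (d : ℕ) (hd : #(G i0).edgeFinset = d + 1)
    (hmax : ∀ i, c i ≠ 0 → #(G i).edgeFinset ≤ d + 1)
    (n r : ℕ) (φ : Fin r × Fin (nv i0) ↪ Fin n) (T : Finset (Sym2 (Fin n)))
    (hT : ∀ j, (G i0).edgeFinset.image (Sym2.map (fun x => φ (j, x))) ⊆ T)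
    (δ : ℝ) (hδ : 0 ≤ δ) (hw : blockW χ d (c i0) ^ r ≤ δ ^ (2 ^ d)) :
    ‖(1 / 2 : ℂ) ^ #T * ∑ S ∈ T.powerset, χ (∑ i, c i * (copyNum n (G i) S : ZMod q))‖ ≤ δ := by
  set ε : Fin (d + 1) ≃ (G i0).edgeFinset := (Finset.equivFinOfCardEq hd).symm with hεdef
  set e : Fin (d + 1) → Fin r → Sym2 (Fin n) :=
    fun s j => Sym2.map (fun x => φ (j, x)) (ε s).1 with hedef
  have hφj : ∀ j, Function.Injective (fun x => φ (j, x)) := by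
    intro j x y h
    have := φ.injective h
    rw [Prod.mk.injEq] at this
    exact this.2
  have heinj : ∀ s j s' j', e s j = e s' j' → s = s' ∧ j = j' := by
    intro s j s' j' h
    have hj : j = j' := by
      simp only [hedef] at h
      generalize (ε s).1 = a at h
      generalize (ε s').1 = b at h
      induction a using Sym2.ind with
      | _ x y =>
        induction b using Sym2.ind with
        | _ x' y' =>
          simp only [Sym2.map_mk, Sym2.eq_iff] at h
          rcases h with ⟨h, -⟩ | ⟨h, -⟩
          · have := φ.injective h
            rw [Prod.mk.injEq] at this
            exact this.1
          · have := φ.injective h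
            rw [Prod.mk.injEq] at this
            exact this.1
    subst hj
    refine ⟨?_, rfl⟩
    have := Sym2.map.injective (hφj j) h
    exact ε.injective (Subtype.ext this)
  have hblock : ∀ j, univ.image (fun s => e s j) =
      (G i0).edgeFinset.image (Sym2.map (fun x => φ (j, x))) := by
    intro j
    ext b
    simp only [mem_image, mem_univ, true_and]
    constructor
    · rintro ⟨s, rfl⟩
      exact ⟨(ε s).1, (ε s).2, rfl⟩
    · rintro ⟨a, ha, rfl⟩
      exact ⟨ε.symm ⟨a, ha⟩, by simp [hedef]⟩
  have hTs : blockSet e ⊆ T := by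
    intro b hb
    obtain ⟨s, j, rfl⟩ := (mem_blockSet e b).1 hb
    apply hT j
    rw [← hblock]
    exact mem_image_of_mem _ (mem_univ s)
  have hmemi0 : ∀ j, univ.image (fun s => e s j) ∈ copyEdges n (G i0) := by
    intro j
    rw [hblock]
    unfold copyEdges
    rw [mem_image]
    exact ⟨⟨fun x => φ (j, x), hφj j⟩, mem_univ _, rfl⟩
  have hrel : ∀ (M : Type) [CommRing M] (i : ι), c i ≠ 0 → ∀ K ∈ copyEdges n (G i),
      ∀ X X' : Fin (d + 1) → Fin r → Bool,
      ∏ s, ((groupFac e K s (X s) : M) - groupFac e K s (X' s)) ≠ 0 →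
      i = i0 ∧ ∃ j, K = univ.image (fun s => e s j) := by
    intro M _ i hci K hK X X' hne
    unfold copyEdges at hK
    rw [mem_image] at hK
    obtain ⟨ψ, -, rfl⟩ := hK
    have hcard : #((G i).edgeFinset.image (Sym2.map ψ)) ≤ d + 1 :=
      card_image_le.trans (hmax i hci)
    obtain ⟨j, hj⟩ := exists_transversal e heinj _ hcard X X' hne
    have hjc := block_eq_of_transversal (G i) (hconn i) (fun s => (ε s).1) φ ψ j hj
    have hK : (G i).edgeFinset.image (Sym2.map ψ) = univ.image (fun s => e s (j 0)) := by
      rw [hj]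
      refine image_congr fun s _ => ?_
      simp only [hjc s]
    refine ⟨?_, j 0, hK⟩
    by_contra hii
    rw [hblock] at hK
    obtain ⟨f⟩ := iso_of_image_eq (h2 i) (h2 i0) (G i) (G i0) (hconn i) (hconn i0) ψ
      ⟨fun x => φ (j 0, x), hφj (j 0)⟩ hK
    exact (hnoniso i i0 hii).false f
  refine avg_le_of_blocks e heinj T hTs _ δ ?_
  intro S0 hS0
  have hb := bias_bound χ d (fun _ : Fin r => c i0)
    (fun X => ∑ i, c i * (copyNum n (G i) (S0 ∪ selSet e X) : ZMod q)) ?_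
  · rw [prod_const, card_univ, Fintype.card_fin] at hb
    exact le_of_pow_le_pow_left₀ (by positivity) hδ (hb.trans hw)
  intro X X'
  have hexp : (fun X => ∑ i, c i * (copyNum n (G i) (S0 ∪ selSet e X) : ZMod q)) =
      fun X => ∑ i, ∑ K ∈ copyEdges n (G i),
        (c i * (if K \ blockSet e ⊆ S0 then 1 else 0)) * ∏ s, groupFac e K s (X s) := by
    funext X
    refine sum_congr rfl fun i _ => ?_
    unfold copyNum
    rw [card_filter]
    push_cast
    rw [mul_sum]
    refine sum_congr rfl fun K _ => ?_
    rw [indicator_eq e heinj K S0 hS0 X]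
    ring
  rw [hexp, cubeDiff_sum]
  have hterm : ∀ i, cubeDiff (d + 1) (fun X => ∑ K ∈ copyEdges n (G i),
        (c i * (if K \ blockSet e ⊆ S0 then 1 else 0)) * ∏ s, groupFac e K s (X s)) X X' =
      ∑ K ∈ copyEdges n (G i), (c i * (if K \ blockSet e ⊆ S0 then 1 else 0)) *
        ∏ s, (groupFac e K s (X s) - groupFac e K s (X' s)) := by
    intro i
    rw [cubeDiff_sum]
    refine sum_congr rfl fun K _ => ?_
    rw [cubeDiff_prod]
  rw [sum_congr rfl fun i _ => hterm i]
  rw [sum_eq_single i0]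
  · have hsub : univ.image (fun j => univ.image (fun s => e s j)) ⊆ copyEdges n (G i0) := by
      intro K hK
      rw [mem_image] at hK
      obtain ⟨j, -, rfl⟩ := hK
      exact hmemi0 j
    rw [← sum_subset hsub]
    · rw [sum_image]
      · refine sum_congr rfl fun j _ => ?_
        rw [mul_assoc, term_of_block e heinj S0 j X X']
      · intro j _ j' _ hjj
        have : e 0 j ∈ univ.image (fun s => e s j') := by
          have h3 : univ.image (fun s => e s j) = univ.image (fun s => e s j') := hjj
          rw [← h3]
          exact mem_image_of_mem _ (mem_univ 0)
        rw [mem_image] at this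
        obtain ⟨s, -, h⟩ := this
        exact (heinj _ _ _ _ h).2.symm
    · intro K hK hKn
      by_contra hne
      by_cases hc : c i0 = 0
      · simp [hc] at hne
      obtain ⟨-, j, hj⟩ := hrel (ZMod q) i0 hc K hK X X' (right_ne_zero_of_mul hne)
      exact hKn (mem_image.2 ⟨j, mem_univ _, hj.symm⟩)
  · intro i _ hi
    refine sum_eq_zero fun K hK => ?_
    by_contra hne
    by_cases hc : c i = 0
    · simp [hc] at hne
    exact hi (hrel (ZMod q) i hc K hK X X' (right_ne_zero_of_mul hne)).1
  · simp

/-! ### First and second moments -/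

/-- All potential edges on `Fin n`. -/
noncomputable def allEdges (n : ℕ) : Finset (Sym2 (Fin n)) :=
  univ.filter (fun e => ¬ e.IsDiag)

lemma chebyshev_subset {β Φ : Type*} [DecidableEq β] [Fintype Φ] (E : Finset β) (p : ℝ)
    (h0 : 0 ≤ p) (h1 : p ≤ 1) (A : Φ → Finset β) (hA : ∀ φ, A φ ⊆ E) (D : ℕ)
    (hD : ∀ φ, #(A φ) = D) :
    (∑ T ∈ E.powerset with ∀ φ, ¬ A φ ⊆ T, subsetWt E p T) *
      ((Fintype.card Φ : ℝ) * p ^ D) ^ 2 ≤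
      ∑ φ, ∑ ψ, (p ^ #(A φ ∪ A ψ) - p ^ (2 * D)) := by
  set M : ℝ := (Fintype.card Φ : ℝ) * p ^ D with hM
  set X : Finset β → ℝ := fun T => ∑ φ, if A φ ⊆ T then 1 else 0 with hX
  have hEX : ∑ T ∈ E.powerset, subsetWt E p T * X T = M := by
    simp only [hX, mul_sum]
    rw [sum_comm]
    have : ∀ φ, ∑ T ∈ E.powerset, subsetWt E p T * (if A φ ⊆ T then (1 : ℝ) else 0) = p ^ D := by
      intro φ
      simp only [mul_ite, mul_one, mul_zero]
      rw [← sum_filter, sum_subsetWt_superset p (hA φ), hD]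
    rw [sum_congr rfl fun φ _ => this φ]
    simp [hM]
  have hEX2 : ∑ T ∈ E.powerset, subsetWt E p T * X T ^ 2 = ∑ φ, ∑ ψ, p ^ #(A φ ∪ A ψ) := by
    have h2 : ∀ T, subsetWt E p T * X T ^ 2 =
        ∑ φ, ∑ ψ, if A φ ∪ A ψ ⊆ T then subsetWt E p T else 0 := by
      intro T
      simp only [hX, sq]
      rw [sum_mul_sum]
      simp only [mul_sum]
      refine sum_congr rfl fun φ _ => sum_congr rfl fun ψ _ => ?_
      by_cases ha : A φ ⊆ T <;> by_cases hb : A ψ ⊆ T <;> simp [union_subset_iff, ha, hb]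
    simp only [h2]
    rw [sum_comm]
    refine sum_congr rfl fun φ _ => ?_
    rw [sum_comm]
    refine sum_congr rfl fun ψ _ => ?_
    rw [← sum_filter, sum_subsetWt_superset p (union_subset (hA φ) (hA ψ))]
  have hvar : ∑ T ∈ E.powerset, subsetWt E p T * (X T - M) ^ 2 =
      ∑ φ, ∑ ψ, (p ^ #(A φ ∪ A ψ) - p ^ (2 * D)) := by
    have h3 : ∀ T, subsetWt E p T * (X T - M) ^ 2 = subsetWt E p T * X T ^ 2
        - (2 * M) * (subsetWt E p T * X T) + M ^ 2 * subsetWt E p T := by intro T; ring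
    simp only [h3, sum_add_distrib, sum_sub_distrib, ← mul_sum, hEX, hEX2, sum_subsetWt]
    simp only [sum_const, card_univ, nsmul_eq_mul, hM]
    ring
  rw [← hvar, sum_mul, sum_filter]
  refine sum_le_sum fun T _ => ?_
  have hw := subsetWt_nonneg E h0 h1 T
  split_ifs with h
  · have : X T = 0 := by
      simp only [hX]
      exact sum_eq_zero fun φ _ => if_neg (h φ)
    rw [this]
    nlinarith
  · positivity

lemma sum_embedding_le {V : Type*} [Fintype V] (n : ℕ) (hn : 1 ≤ n)
    (φ : V ↪ Fin n) :
    ∑ ψ : V ↪ Fin n, ∏ y, (if ψ y ∈ Set.range φ then (n : ℝ) else 1) ≤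
      (((Fintype.card V : ℝ) + 1) * n) ^ Fintype.card V := by
  have h1 : ∑ ψ : V ↪ Fin n, ∏ y, (if ψ y ∈ Set.range φ then (n : ℝ) else 1) ≤
      ∑ f : V → Fin n, ∏ y, (if f y ∈ Set.range φ then (n : ℝ) else 1) := by
    have h2 : ∑ ψ : V ↪ Fin n, ∏ y, (if ψ y ∈ Set.range φ then (n : ℝ) else 1) =
        ∑ f ∈ univ.map ⟨fun ψ : V ↪ Fin n => (ψ : V → Fin n), DFunLike.coe_injective⟩,
          ∏ y, (if f y ∈ Set.range φ then (n : ℝ) else 1) := by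
      rw [sum_map]
      rfl
    rw [h2]
    refine sum_le_sum_of_subset_of_nonneg (subset_univ _) fun f _ _ => prod_nonneg fun y _ => ?_
    split_ifs <;> positivity
  refine h1.trans ?_
  rw [← Fintype.prod_sum (fun (_ : V) (z : Fin n) => if z ∈ Set.range φ then (n : ℝ) else 1)]
  rw [prod_const, card_univ]
  refine pow_le_pow_left₀ (sum_nonneg fun z _ => by split_ifs <;> positivity) ?_ _
  have h3 : ∀ z : Fin n, (if z ∈ Set.range φ then (n : ℝ) else 1) ≤
      (if z ∈ Set.range φ then (n : ℝ) else 0) + 1 := by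
    intro z
    split_ifs <;> simp
  refine (sum_le_sum fun z _ => h3 z).trans ?_
  rw [sum_add_distrib, ← sum_filter, sum_const, sum_const, card_univ, Fintype.card_fin]
  have h4 : #(univ.filter (fun z => z ∈ Set.range φ)) = Fintype.card V := by
    have : univ.filter (fun z => z ∈ Set.range φ) = univ.map φ := by
      ext z
      simp
    rw [this, card_map, card_univ]
  rw [h4]
  simp only [nsmul_eq_mul, mul_one]
  linarith

lemma image_subset_allEdges {V : Type*} [Fintype V] {n : ℕ} (D : Finset (Sym2 V))
    (hD : ∀ e ∈ D, ¬ e.IsDiag) (φ : V ↪ Fin n) :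
    D.image (Sym2.map φ) ⊆ allEdges n := by
  intro b hb
  rw [mem_image] at hb
  obtain ⟨e, he, rfl⟩ := hb
  rw [allEdges, mem_filter]
  refine ⟨mem_univ _, ?_⟩
  rw [Sym2.isDiag_map φ.injective]
  exact hD e he

lemma exists_gap {V : Type*} [Fintype V] (D : Finset (Sym2 V)) (α : ℝ)
    (hdens : ∀ W : Finset V, W.Nonempty →
      α * #(D.filter (fun e => ∀ x ∈ e, x ∈ W)) < #W) :
    ∃ δ : ℝ, 0 < δ ∧ ∀ W : Finset V, W.Nonempty →
      α * #(D.filter (fun e => ∀ x ∈ e, x ∈ W)) ≤ #W - δ := by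
  set f : Finset V → ℝ := fun W =>
    if W.Nonempty then #W - α * #(D.filter (fun e => ∀ x ∈ e, x ∈ W)) else 1 with hf
  obtain ⟨W0, hW0⟩ := Finite.exists_min f
  refine ⟨f W0, ?_, ?_⟩
  · simp only [hf]
    split_ifs with h
    · have := hdens W0 h
      linarith
    · norm_num
  · intro W hW
    have := hW0 W
    have h2 : f W = #W - α * #(D.filter (fun e => ∀ x ∈ e, x ∈ W)) := by
      simp only [hf]
      rw [if_pos hW]
    linarith

lemma pair_bound {V : Type*} [Fintype V] (D : Finset (Sym2 V)) (α : ℝ) (hα : 0 < α)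
    (δ : ℝ) (hδ : ∀ W : Finset V, W.Nonempty →
      α * #(D.filter (fun e => ∀ x ∈ e, x ∈ W)) ≤ #W - δ)
    (n : ℕ) (hn : 1 ≤ n) (p : ℝ) (hp : (n : ℝ) ^ (-α) ≤ p) (φ ψ : V ↪ Fin n) :
    p ^ #(D.image (Sym2.map φ) ∪ D.image (Sym2.map ψ)) - p ^ (2 * #D) ≤
      p ^ (2 * #D) * (n : ℝ) ^ (-δ) * ∏ y, (if ψ y ∈ Set.range φ then (n : ℝ) else 1) := by
  have hn0 : (0 : ℝ) < n := by exact_mod_cast hn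
  have hn1 : (1 : ℝ) ≤ n := by exact_mod_cast hn
  have hp0 : 0 < p := lt_of_lt_of_le (Real.rpow_pos_of_pos hn0 _) hp
  set I := D.image (Sym2.map φ) ∩ D.image (Sym2.map ψ) with hI
  have hcφ : #(D.image (Sym2.map φ)) = #D :=
    card_image_of_injective _ (Sym2.map.injective φ.injective)
  have hcψ : #(D.image (Sym2.map ψ)) = #D :=
    card_image_of_injective _ (Sym2.map.injective ψ.injective)
  have hcu := card_union_add_card_inter (D.image (Sym2.map φ)) (D.image (Sym2.map ψ))
  rw [hcφ, hcψ, ← hI] at hcu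
  have hprod : ∏ y, (if ψ y ∈ Set.range φ then (n : ℝ) else 1) =
      (n : ℝ) ^ (#(univ.filter (fun y => ψ y ∈ Set.range φ)) : ℝ) := by
    rw [← prod_filter, prod_const, Real.rpow_natCast]
  set W := univ.filter (fun y => ψ y ∈ Set.range φ) with hW
  have hRHS : 0 ≤ p ^ (2 * #D) * (n : ℝ) ^ (-δ) *
      ∏ y, (if ψ y ∈ Set.range φ then (n : ℝ) else 1) := by
    rw [hprod]
    positivity
  by_cases hI0 : #I = 0
  · have : #(D.image (Sym2.map φ) ∪ D.image (Sym2.map ψ)) = 2 * #D := by omega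
    rw [this, sub_self]
    exact hRHS
  have hIsub : I ⊆ (D.filter (fun e => ∀ x ∈ e, x ∈ W)).image (Sym2.map ψ) := by
    intro b hb
    rw [hI, mem_inter, mem_image, mem_image] at hb
    obtain ⟨⟨a, ha, hab⟩, e, he, rfl⟩ := hb
    refine mem_image_of_mem _ (mem_filter.2 ⟨he, ?_⟩)
    intro x hx
    rw [hW, mem_filter]
    refine ⟨mem_univ _, ?_⟩
    have hm : ψ x ∈ Sym2.map φ a := by
      rw [hab]
      exact Sym2.mem_map.2 ⟨x, hx, rfl⟩
    obtain ⟨y, -, hy⟩ := Sym2.mem_map.1 hm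
    exact ⟨y, hy⟩
  have hIle : #I ≤ #(D.filter (fun e => ∀ x ∈ e, x ∈ W)) :=
    (card_le_card hIsub).trans card_image_le
  have hWne : W.Nonempty := by
    have : 0 < #(D.filter (fun e => ∀ x ∈ e, x ∈ W)) := by omega
    obtain ⟨e, he⟩ := card_pos.1 this
    rw [mem_filter] at he
    have he2 := he.2
    clear he
    induction e using Sym2.ind with
    | _ a b => exact ⟨a, he2 a (Sym2.mem_mk_left a b)⟩
  have hgap := hδ W hWne
  have hpI : p ^ #(D.image (Sym2.map φ) ∪ D.image (Sym2.map ψ)) ≤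
      p ^ (2 * #D) * (n : ℝ) ^ (α * #I) := by
    have h1 : 1 ≤ p ^ #I * (n : ℝ) ^ (α * #I) := by
      have h2 : ((n : ℝ) ^ (-α)) ^ #I * (n : ℝ) ^ (α * #I) = 1 := by
        rw [← Real.rpow_natCast, ← Real.rpow_mul hn0.le, ← Real.rpow_add hn0]
        simp
      rw [← h2]
      gcongr
    have h3 : p ^ (2 * #D) = p ^ #(D.image (Sym2.map φ) ∪ D.image (Sym2.map ψ)) * p ^ #I := by
      rw [← pow_add]
      congr 1
      omega
    rw [h3, mul_assoc]
    exact le_mul_of_one_le_right (by positivity) h1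
  have hexp : (n : ℝ) ^ (α * #I) ≤ (n : ℝ) ^ (-δ) * (n : ℝ) ^ (#W : ℝ) := by
    rw [← Real.rpow_add hn0]
    apply Real.rpow_le_rpow_of_exponent_le hn1
    have : α * (#I : ℝ) ≤ α * #(D.filter (fun e => ∀ x ∈ e, x ∈ W)) := by
      have : (#I : ℝ) ≤ #(D.filter (fun e => ∀ x ∈ e, x ∈ W)) := by exact_mod_cast hIle
      gcongr
    linarith
  rw [hprod]
  have h5 : 0 ≤ p ^ (2 * #D) := by positivity
  have h6 := mul_le_mul_of_nonneg_left hexp h5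
  rw [mul_assoc]
  linarith

lemma second_moment {V : Type*} [Fintype V] (D : Finset (Sym2 V))
    (hD : ∀ e ∈ D, ¬ e.IsDiag) (α : ℝ) (hα : 0 < α)
    (hdens : ∀ W : Finset V, W.Nonempty →
      α * #(D.filter (fun e => ∀ x ∈ e, x ∈ W)) < #W) :
    Tendsto (fun n : ℕ => ∑ T ∈ (allEdges n).powerset with
        ∀ φ : V ↪ Fin n, ¬ D.image (Sym2.map φ) ⊆ T,
        subsetWt (allEdges n) (2 * (n : ℝ) ^ (-α)) T) atTop (nhds 0) := by
  obtain ⟨δ, hδ0, hδ⟩ := exists_gap D α hdens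
  set v := Fintype.card V with hv
  have hlim : Tendsto (fun n : ℕ => (n : ℝ) ^ (-α)) atTop (nhds 0) :=
    (tendsto_rpow_neg_atTop hα).comp tendsto_natCast_atTop_atTop
  have hlim2 : Tendsto (fun n : ℕ => (2 * ((v : ℝ) + 1)) ^ v * (n : ℝ) ^ (-δ)) atTop (nhds 0) := by
    have := ((tendsto_rpow_neg_atTop hδ0).comp tendsto_natCast_atTop_atTop).const_mul
      ((2 * ((v : ℝ) + 1)) ^ v)
    simpa using this
  have hsmall : ∀ᶠ n : ℕ in atTop, (n : ℝ) ^ (-α) ≤ 1 / 2 :=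
    hlim.eventually (Iic_mem_nhds (by norm_num))
  refine squeeze_zero' ?_ ?_ hlim2
  · filter_upwards [hsmall] with n hn
    refine sum_nonneg fun T _ => subsetWt_nonneg _ (by positivity) (by linarith) _
  · filter_upwards [hsmall, eventually_ge_atTop (2 * v + 1)] with n hn hn2
    have hn1 : 1 ≤ n := by omega
    have hn0 : (0 : ℝ) < n := by exact_mod_cast hn1
    set p : ℝ := 2 * (n : ℝ) ^ (-α) with hp
    have hq0 : 0 < (n : ℝ) ^ (-α) := Real.rpow_pos_of_pos hn0 _
    have hp0 : 0 < p := by positivity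
    have hc := chebyshev_subset (allEdges n) p hp0.le (by linarith)
      (fun φ : V ↪ Fin n => D.image (Sym2.map φ)) (fun φ => image_subset_allEdges D hD φ) #D
      (fun φ => card_image_of_injective _ (Sym2.map.injective φ.injective))
    set Q := ∑ T ∈ (allEdges n).powerset with
        ∀ φ : V ↪ Fin n, ¬ D.image (Sym2.map φ) ⊆ T, subsetWt (allEdges n) p T with hQ
    set N : ℝ := (Fintype.card (V ↪ Fin n) : ℝ) with hN
    have hNlow : ((n : ℝ) / 2) ^ v ≤ N := by
      have h1 := Nat.pow_sub_le_descFactorial n v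
      have h2 : Fintype.card (V ↪ Fin n) = n.descFactorial v := by
        rw [Fintype.card_embedding_eq, Fintype.card_fin]
      rw [hN, h2]
      have h3 : (((n + 1 - v) ^ v : ℕ) : ℝ) ≤ (n.descFactorial v : ℝ) := by exact_mod_cast h1
      refine le_trans ?_ h3
      push_cast
      refine pow_le_pow_left₀ (by positivity) ?_ _
      rw [Nat.cast_sub (by omega)]
      push_cast
      have : (2 * (v : ℝ) + 1) ≤ n := by exact_mod_cast hn2
      linarith
    have hNpos : 0 < N := lt_of_lt_of_le (by positivity) hNlow
    have hsum : ∑ φ : V ↪ Fin n, ∑ ψ : V ↪ Fin n,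
        (p ^ #(D.image (Sym2.map φ) ∪ D.image (Sym2.map ψ)) - p ^ (2 * #D)) ≤
        N * (p ^ (2 * #D) * (n : ℝ) ^ (-δ) * (((v : ℝ) + 1) * n) ^ v) := by
      have h1 : ∀ φ : V ↪ Fin n, ∑ ψ : V ↪ Fin n,
        (p ^ #(D.image (Sym2.map φ) ∪ D.image (Sym2.map ψ)) - p ^ (2 * #D)) ≤
          p ^ (2 * #D) * (n : ℝ) ^ (-δ) * (((v : ℝ) + 1) * n) ^ v := by
        intro φ
        refine (sum_le_sum fun ψ _ => pair_bound D α hα δ hδ n hn1 p (by linarith) φ ψ).trans ?_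
        rw [← mul_sum]
        exact mul_le_mul_of_nonneg_left (sum_embedding_le n hn1 φ) (by positivity)
      refine (sum_le_sum fun φ _ => h1 φ).trans ?_
      rw [sum_const, card_univ, nsmul_eq_mul]
    have hfin := hc.trans hsum
    have h7 : Q * N ≤ (n : ℝ) ^ (-δ) * (((v : ℝ) + 1) * n) ^ v := by
      have hpos : 0 < N * p ^ (2 * #D) := by positivity
      refine le_of_mul_le_mul_right ?_ hpos
      calc Q * N * (N * p ^ (2 * #D)) = Q * (N * p ^ #D) ^ 2 := by ring
        _ ≤ _ := hfin
        _ = _ := by ring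
    have h8 : (((v : ℝ) + 1) * n) ^ v = (2 * ((v : ℝ) + 1)) ^ v * ((n : ℝ) / 2) ^ v := by
      rw [← mul_pow]
      congr 1
      ring
    refine le_of_mul_le_mul_right ?_ hNpos
    refine h7.trans ?_
    rw [h8]
    calc (n : ℝ) ^ (-δ) * ((2 * ((v : ℝ) + 1)) ^ v * ((n : ℝ) / 2) ^ v)
        = (2 * ((v : ℝ) + 1)) ^ v * (n : ℝ) ^ (-δ) * ((n : ℝ) / 2) ^ v := by ring
      _ ≤ _ := mul_le_mul_of_nonneg_left hNlow (by positivity)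

lemma first_moment {V : Type*} [Fintype V] (D : Finset (Sym2 V))
    (hD : ∀ e ∈ D, ¬ e.IsDiag) (α : ℝ) (hα : 0 < α)
    (hdens : (Fintype.card V : ℝ) < α * #D) :
    Tendsto (fun n : ℕ => ∑ T ∈ (allEdges n).powerset with
        ∃ φ : V ↪ Fin n, D.image (Sym2.map φ) ⊆ T,
        subsetWt (allEdges n) ((n : ℝ) ^ (-α)) T) atTop (nhds 0) := by
  have hpos : 0 < α * #D - Fintype.card V := by linarith
  have hlim : Tendsto (fun n : ℕ => (n : ℝ) ^ (-(α * #D - Fintype.card V))) atTop (nhds 0) :=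
    (tendsto_rpow_neg_atTop hpos).comp tendsto_natCast_atTop_atTop
  have hle1 : ∀ n : ℕ, 1 ≤ n → (n : ℝ) ^ (-α) ≤ 1 := by
    intro n hn
    exact Real.rpow_le_one_of_one_le_of_nonpos (by exact_mod_cast hn) (by linarith)
  refine squeeze_zero' ?_ ?_ hlim
  · filter_upwards [eventually_ge_atTop 1] with n hn
    exact sum_nonneg fun T _ => subsetWt_nonneg _ (by positivity) (hle1 n hn) _
  · filter_upwards [eventually_ge_atTop 1] with n hn
    have hn0 : (0 : ℝ) < n := by exact_mod_cast hn
    set p : ℝ := (n : ℝ) ^ (-α) with hp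
    have h1 : ∑ T ∈ (allEdges n).powerset with
        ∃ φ : V ↪ Fin n, D.image (Sym2.map φ) ⊆ T, subsetWt (allEdges n) p T ≤
        ∑ φ : V ↪ Fin n, ∑ T ∈ (allEdges n).powerset with
          D.image (Sym2.map φ) ⊆ T, subsetWt (allEdges n) p T := by
      simp only [sum_filter]
      rw [sum_comm]
      refine sum_le_sum fun T _ => ?_
      have hw := subsetWt_nonneg (allEdges n) (p := p) (by positivity) (hle1 n hn) T
      have hnn : ∀ φ ∈ (univ : Finset (V ↪ Fin n)),
          0 ≤ if D.image (Sym2.map φ) ⊆ T then subsetWt (allEdges n) p T else 0 := by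
        intro φ _
        split_ifs
        · exact hw
        · exact le_refl _
      split_ifs with h
      · obtain ⟨φ, hφ⟩ := h
        refine le_trans ?_ (single_le_sum hnn (mem_univ φ))
        rw [if_pos hφ]
      · exact sum_nonneg hnn
    refine h1.trans ?_
    have h2 : ∀ φ : V ↪ Fin n, ∑ T ∈ (allEdges n).powerset with
          D.image (Sym2.map φ) ⊆ T, subsetWt (allEdges n) p T = p ^ #D := by
      intro φ
      rw [sum_subsetWt_superset p (image_subset_allEdges D hD φ),
        card_image_of_injective _ (Sym2.map.injective φ.injective)]
    rw [sum_congr rfl fun φ _ => h2 φ, sum_const, card_univ, nsmul_eq_mul]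
    have h3 : (Fintype.card (V ↪ Fin n) : ℝ) ≤ (n : ℝ) ^ (Fintype.card V : ℝ) := by
      rw [Real.rpow_natCast, Fintype.card_embedding_eq, Fintype.card_fin]
      exact_mod_cast Nat.descFactorial_le_pow n (Fintype.card V)
    have h4 : p ^ #D = (n : ℝ) ^ (-(α * #D)) := by
      rw [hp, ← Real.rpow_natCast, ← Real.rpow_mul hn0.le]
      congr 1
      ring
    calc (Fintype.card (V ↪ Fin n) : ℝ) * p ^ #D
        ≤ (n : ℝ) ^ (Fintype.card V : ℝ) * p ^ #D := by gcongr
      _ = _ := by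
        rw [h4, ← Real.rpow_add hn0]
        congr 1
        ring

/-! ### Assembly -/

lemma union_density {v : ℕ} (r : ℕ) (D : Finset (Sym2 (Fin v))) (α : ℝ) (hα : 0 < α)
    (hdens : ∀ W : Finset (Fin v), W.Nonempty →
      α * #(D.filter (fun e => ∀ x ∈ e, x ∈ W)) < #W)
    (hD : ∀ W : Finset (Fin v), ¬ W.Nonempty → D.filter (fun e => ∀ x ∈ e, x ∈ W) = ∅)
    (W : Finset (Fin r × Fin v)) (hW : W.Nonempty) :
    α * #((univ.biUnion (fun j : Fin r => D.image (Sym2.map (Prod.mk j)))).filter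
      (fun e => ∀ x ∈ e, x ∈ W)) < #W := by
  set Wj : Fin r → Finset (Fin v) := fun j => univ.filter (fun x => (j, x) ∈ W) with hWj
  have h1 : (univ.biUnion (fun j : Fin r => D.image (Sym2.map (Prod.mk j)))).filter
      (fun e => ∀ x ∈ e, x ∈ W) ⊆ univ.biUnion (fun j : Fin r =>
        (D.filter (fun e => ∀ x ∈ e, x ∈ Wj j)).image (Sym2.map (Prod.mk j))) := by
    intro b hb
    rw [mem_filter, mem_biUnion] at hb
    obtain ⟨⟨j, -, hj⟩, hb⟩ := hb
    rw [mem_image] at hj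
    obtain ⟨e, he, rfl⟩ := hj
    rw [mem_biUnion]
    refine ⟨j, mem_univ _, mem_image_of_mem _ (mem_filter.2 ⟨he, fun x hx => ?_⟩)⟩
    simp only [hWj, mem_filter, mem_univ, true_and]
    exact hb _ (Sym2.mem_map.2 ⟨x, hx, rfl⟩)
  have h2 : #((univ.biUnion (fun j : Fin r => D.image (Sym2.map (Prod.mk j)))).filter
      (fun e => ∀ x ∈ e, x ∈ W)) ≤ ∑ j, #(D.filter (fun e => ∀ x ∈ e, x ∈ Wj j)) :=
    (card_le_card h1).trans (card_biUnion_le.trans (sum_le_sum fun j _ => card_image_le))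
  have h3 : #W = ∑ j, #(Wj j) := by
    rw [card_eq_sum_card_fiberwise (f := Prod.fst) (t := univ) (fun _ _ => mem_univ _)]
    refine sum_congr rfl fun j _ => ?_
    refine card_bij (fun t _ => t.2) ?_ ?_ ?_
    · rintro ⟨j', x⟩ h
      simp only [mem_filter, hWj, mem_univ, true_and] at h ⊢
      obtain ⟨h, rfl⟩ := h
      exact h
    · rintro ⟨j1, x⟩ h ⟨j2, y⟩ h' hxy
      simp only [mem_filter] at h h' hxy
      rw [h.2, h'.2, hxy]
    · intro x hx
      simp only [hWj, mem_filter, mem_univ, true_and] at hx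
      exact ⟨(j, x), by simp [hx], rfl⟩
  have h4 : ∑ j, α * (#(D.filter (fun e => ∀ x ∈ e, x ∈ Wj j)) : ℝ) < ∑ j, (#(Wj j) : ℝ) := by
    obtain ⟨⟨j0, x0⟩, hx0⟩ := hW
    refine sum_lt_sum (fun j _ => ?_) ⟨j0, mem_univ _, hdens _ ⟨x0, by simp [hWj, hx0]⟩⟩
    by_cases hne : (Wj j).Nonempty
    · exact (hdens _ hne).le
    · rw [hD _ hne]
      simp
  rw [← mul_sum] at h4
  have h5 : (#((univ.biUnion (fun j : Fin r => D.image (Sym2.map (Prod.mk j)))).filter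
      (fun e => ∀ x ∈ e, x ∈ W)) : ℝ) ≤ ∑ j, (#(D.filter (fun e => ∀ x ∈ e, x ∈ Wj j)) : ℝ) := by
    exact_mod_cast h2
  have h6 : (#W : ℝ) = ∑ j, (#(Wj j) : ℝ) := by exact_mod_cast h3
  rw [h6]
  exact lt_of_le_of_lt (mul_le_mul_of_nonneg_left h5 hα.le) h4

set_option maxHeartbeats 800000 in
lemma bias_tendsto {q : ℕ} [NeZero q] (χ : AddChar (ZMod q) ℂ) (hχ : ∀ c, c ≠ 0 → χ c ≠ 1)
    {ι : Type*} [Fintype ι]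
    (nv : ι → ℕ) (h2 : ∀ i, 2 ≤ nv i) (G : ∀ i, SimpleGraph (Fin (nv i)))
    (hconn : ∀ i, (G i).Connected) (hnoniso : ∀ i j, i ≠ j → IsEmpty ((G i) ≃g (G j)))
    (α : ℝ) (hα : 0 < α)
    (hdens : ∀ i, ∀ W : Finset (Fin (nv i)), W.Nonempty →
      α * #((G i).edgeFinset.filter (fun e => ∀ x ∈ e, x ∈ W)) < #W)
    (c : ι → ZMod q) (hc : c ≠ 0) :
    Tendsto (fun n : ℕ => ∑ S ∈ (allEdges n).powerset,
      (subsetWt (allEdges n) ((n : ℝ) ^ (-α)) S : ℂ) *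
        χ (∑ i, c i * (copyNum n (G i) S : ZMod q))) atTop (nhds 0) := by
  obtain ⟨i1, hi1⟩ := Function.ne_iff.1 hc
  obtain ⟨i0, hi0, hmax⟩ := exists_max_image (univ.filter (fun i => c i ≠ 0))
    (fun i => #(G i).edgeFinset) ⟨i1, by simpa using hi1⟩
  rw [mem_filter] at hi0
  have hci0 := hi0.2
  have hepos : 0 < #(G i0).edgeFinset := by
    obtain ⟨y, hy⟩ := exists_adj_of_connected (h2 i0) (hconn i0) ⟨0, by have := h2 i0; omega⟩
    exact card_pos.2 ⟨s(_, y), SimpleGraph.mem_edgeFinset.2 hy⟩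
  obtain ⟨d, hd⟩ := Nat.exists_eq_succ_of_ne_zero hepos.ne'
  have hmax' : ∀ i, c i ≠ 0 → #(G i).edgeFinset ≤ d + 1 := by
    intro i hi
    have := hmax i (mem_filter.2 ⟨mem_univ _, hi⟩)
    omega
  have hlim : Tendsto (fun n : ℕ => (n : ℝ) ^ (-α)) atTop (nhds 0) :=
    (tendsto_rpow_neg_atTop hα).comp tendsto_natCast_atTop_atTop
  have hsmall : ∀ᶠ n : ℕ in atTop, (n : ℝ) ^ (-α) ≤ 1 / 2 :=
    hlim.eventually (Iic_mem_nhds (by norm_num))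
  rw [Metric.tendsto_atTop']
  intro ε hε
  obtain ⟨r, hr⟩ := exists_pow_lt_of_lt_one (show (0 : ℝ) < (ε / 2) ^ (2 ^ d) by positivity)
    (blockW_lt_one χ hχ d (c i0) hci0)
  set D : Finset (Sym2 (Fin r × Fin (nv i0))) :=
    univ.biUnion (fun j : Fin r => (G i0).edgeFinset.image (Sym2.map (Prod.mk j))) with hDdef
  have hnd : ∀ e ∈ D, ¬ e.IsDiag := by
    intro e he
    rw [hDdef, mem_biUnion] at he
    obtain ⟨j, -, he⟩ := he
    rw [mem_image] at he
    obtain ⟨e, he, rfl⟩ := he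
    rw [Sym2.isDiag_map (Prod.mk_right_injective j)]
    exact SimpleGraph.not_isDiag_of_mem_edgeFinset he
  have hempty : ∀ W : Finset (Fin (nv i0)), ¬ W.Nonempty →
      (G i0).edgeFinset.filter (fun e => ∀ x ∈ e, x ∈ W) = ∅ := by
    intro W hW
    rw [filter_eq_empty_iff]
    intro e he h
    apply hW
    clear he
    induction e using Sym2.ind with
    | _ a b => exact ⟨a, h a (Sym2.mem_mk_left a b)⟩
  have hsm := second_moment D hnd α hα (fun W hW => by
    have hud := union_density r (G i0).edgeFinset α hα (hdens i0) hempty W hW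
    convert hud using 4
    ext e
    simp only [mem_filter, hDdef, mem_biUnion, mem_image])
  have hbad := hsm.eventually (Iio_mem_nhds (show (0 : ℝ) < ε / 2 by positivity))
  have hev : ∀ᶠ n : ℕ in atTop, dist (∑ S ∈ (allEdges n).powerset,
      (subsetWt (allEdges n) ((n : ℝ) ^ (-α)) S : ℂ) *
        χ (∑ i, c i * (copyNum n (G i) S : ZMod q))) 0 < ε := by
    filter_upwards [hsmall, hbad] with n hn hb
    rw [dist_zero_right, thinning]
    have hw : ∀ T, 0 ≤ subsetWt (allEdges n) (2 * (n : ℝ) ^ (-α)) T := fun T =>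
      subsetWt_nonneg _ (by positivity) (by linarith) _
    refine lt_of_le_of_lt (norm_sum_le _ _) ?_
    have hterm : ∀ T ∈ (allEdges n).powerset,
        ‖(subsetWt (allEdges n) (2 * (n : ℝ) ^ (-α)) T : ℂ) * ((1 / 2 : ℂ) ^ #T *
          ∑ S ∈ T.powerset, χ (∑ i, c i * (copyNum n (G i) S : ZMod q)))‖ ≤
        (if ∀ φ : Fin r × Fin (nv i0) ↪ Fin n, ¬ D.image (Sym2.map φ) ⊆ T then
          subsetWt (allEdges n) (2 * (n : ℝ) ^ (-α)) T else 0) +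
          subsetWt (allEdges n) (2 * (n : ℝ) ^ (-α)) T * (ε / 2) := by
      intro T _
      rw [norm_mul, Complex.norm_real, Real.norm_of_nonneg (hw T)]
      have hwT := hw T
      split_ifs with h
      · have h1 : ‖(1 / 2 : ℂ) ^ #T *
            ∑ S ∈ T.powerset, χ (∑ i, c i * (copyNum n (G i) S : ZMod q))‖ ≤ 1 := by
          rw [norm_mul, norm_pow]
          simp only [one_div, norm_inv, Complex.norm_ofNat, inv_pow]
          rw [inv_mul_le_iff₀ (by positivity), mul_one]
          refine (norm_sum_le _ _).trans (le_of_eq ?_)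
          simp
        have h3 := mul_le_mul_of_nonneg_left h1 hwT
        have : 0 ≤ subsetWt (allEdges n) (2 * (n : ℝ) ^ (-α)) T * (ε / 2) := by positivity
        linarith
      · push Not at h
        obtain ⟨φ, hφ⟩ := h
        rw [zero_add]
        refine mul_le_mul_of_nonneg_left ?_ hwT
        refine avg_char_le χ nv h2 G hconn hnoniso c i0 d hd hmax' n r φ T ?_ (ε / 2)
          (by positivity) hr.le
        intro j b hb
        rw [mem_image] at hb
        obtain ⟨e, he, rfl⟩ := hb
        apply hφ
        rw [mem_image]
        refine ⟨Sym2.map (Prod.mk j) e, ?_, ?_⟩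
        · rw [hDdef, mem_biUnion]
          exact ⟨j, mem_univ _, mem_image_of_mem _ he⟩
        · rw [Sym2.map_map]
          rfl
    refine lt_of_le_of_lt (sum_le_sum hterm) ?_
    rw [sum_add_distrib, ← sum_mul, sum_subsetWt, ← sum_filter]
    linarith
  rw [eventually_atTop] at hev
  obtain ⟨N, hN⟩ := hev
  exact ⟨N, fun n hn => hN n hn.le⟩

lemma indicator_char {q : ℕ} [NeZero q] (χ : AddChar (ZMod q) ℂ) (hχ : χ.IsPrimitive)
    {ι : Type*} [Fintype ι] (b : ι → ZMod q) :
    (if ∀ i, b i = 0 then (1 : ℂ) else 0) =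
      (1 / (q : ℂ)) ^ Fintype.card ι * ∑ c : ι → ZMod q, χ (∑ i, c i * b i) := by
  have hq : (q : ℂ) ≠ 0 := Nat.cast_ne_zero.2 (NeZero.ne q)
  have h1 : ∑ c : ι → ZMod q, χ (∑ i, c i * b i) = ∏ i, if b i = 0 then (q : ℂ) else 0 := by
    simp only [addChar_map_sum]
    rw [← Fintype.prod_sum (fun (i : ι) (x : ZMod q) => χ (x * b i))]
    refine prod_congr rfl fun i _ => ?_
    rw [AddChar.sum_mulShift (b i) hχ, ZMod.card]
    split_ifs <;> simp
  rw [h1]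
  split_ifs with h
  · rw [prod_congr rfl fun i _ => if_pos (h i), prod_const, card_univ, ← mul_pow]
    rw [one_div, inv_mul_cancel₀ hq, one_pow]
  · push Not at h
    obtain ⟨i, hi⟩ := h
    rw [prod_eq_zero (mem_univ i) (if_neg hi), mul_zero]

lemma uniform_limit {q : ℕ} [NeZero q]
    {ι : Type*} [Fintype ι]
    (nv : ι → ℕ) (h2 : ∀ i, 2 ≤ nv i) (G : ∀ i, SimpleGraph (Fin (nv i)))
    (hconn : ∀ i, (G i).Connected) (hnoniso : ∀ i j, i ≠ j → IsEmpty ((G i) ≃g (G j)))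
    (α : ℝ) (hα : 0 < α)
    (hdens : ∀ i, ∀ W : Finset (Fin (nv i)), W.Nonempty →
      α * #((G i).edgeFinset.filter (fun e => ∀ x ∈ e, x ∈ W)) < #W)
    (a : ι → ZMod q) :
    Tendsto (fun n : ℕ => ∑ S ∈ (allEdges n).powerset with
        ∀ i, (copyNum n (G i) S : ZMod q) = a i,
      subsetWt (allEdges n) ((n : ℝ) ^ (-α)) S) atTop
      (nhds (((1 : ℝ) / q) ^ Fintype.card ι)) := by
  set χ : AddChar (ZMod q) ℂ := ZMod.stdAddChar with hχdef
  have hprim : χ.IsPrimitive := ZMod.isPrimitive_stdAddChar q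
  have hχ : ∀ c, c ≠ 0 → χ c ≠ 1 := by
    intro c hc h
    apply hc
    have h0 : χ c = χ 0 := by rw [h, AddChar.map_zero_eq_one]
    exact ZMod.injective_stdAddChar h0
  have hrep : ∀ n : ℕ, ((∑ S ∈ (allEdges n).powerset with
        ∀ i, (copyNum n (G i) S : ZMod q) = a i,
      subsetWt (allEdges n) ((n : ℝ) ^ (-α)) S : ℝ) : ℂ) =
      (1 / (q : ℂ)) ^ Fintype.card ι * ∑ c : ι → ZMod q, χ (- ∑ i, c i * a i) *
        ∑ S ∈ (allEdges n).powerset, (subsetWt (allEdges n) ((n : ℝ) ^ (-α)) S : ℂ) *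
        χ (∑ i, c i * (copyNum n (G i) S : ZMod q)) := by
    intro n
    rw [sum_filter]
    push_cast
    simp only [mul_sum]
    rw [sum_comm]
    refine sum_congr rfl fun S _ => ?_
    have h1 := indicator_char χ hprim (fun i => (copyNum n (G i) S : ZMod q) - a i)
    simp only [sub_eq_zero] at h1
    have h3 : ((if ∀ i, (copyNum n (G i) S : ZMod q) = a i then
        subsetWt (allEdges n) ((n : ℝ) ^ (-α)) S else 0 : ℝ) : ℂ) =
        (subsetWt (allEdges n) ((n : ℝ) ^ (-α)) S : ℂ) *
        (if ∀ i, (copyNum n (G i) S : ZMod q) = a i then (1 : ℂ) else 0) := by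
      split_ifs <;> simp
    rw [h3, h1, mul_sum, mul_sum]
    refine sum_congr rfl fun c _ => ?_
    have h4 : χ (∑ i, c i * ((copyNum n (G i) S : ZMod q) - a i)) =
        χ (- ∑ i, c i * a i) * χ (∑ i, c i * (copyNum n (G i) S : ZMod q)) := by
      rw [← AddChar.map_add_eq_mul]
      congr 1
      simp only [mul_sub, sum_sub_distrib]
      ring
    rw [h4]
    ring
  have hlimc : Tendsto (fun n : ℕ => (1 / (q : ℂ)) ^ Fintype.card ι *
      ∑ c : ι → ZMod q, χ (- ∑ i, c i * a i) *
        ∑ S ∈ (allEdges n).powerset, (subsetWt (allEdges n) ((n : ℝ) ^ (-α)) S : ℂ) *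
        χ (∑ i, c i * (copyNum n (G i) S : ZMod q))) atTop
      (nhds ((1 / (q : ℂ)) ^ Fintype.card ι *
        ∑ c : ι → ZMod q, if c = 0 then (1 : ℂ) else 0)) := by
    refine Tendsto.const_mul _ (tendsto_finsetSum _ fun c _ => ?_)
    split_ifs with hc
    · subst hc
      refine tendsto_const_nhds.congr fun n => ?_
      simp only [Pi.zero_apply, zero_mul, sum_const_zero, neg_zero, AddChar.map_zero_eq_one,
        mul_one, one_mul]
      rw [← Complex.ofReal_sum, sum_subsetWt, Complex.ofReal_one]
    · have := (bias_tendsto χ hχ nv h2 G hconn hnoniso α hα hdens c hc).const_mul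
        (χ (- ∑ i, c i * a i))
      simpa using this
  rw [sum_ite_eq' univ (0 : ι → ZMod q), if_pos (mem_univ _), mul_one] at hlimc
  have hre := (Complex.continuous_re.tendsto _).comp hlimc
  have hval : ((1 / (q : ℂ)) ^ Fintype.card ι).re = ((1 : ℝ) / q) ^ Fintype.card ι := by
    have : (1 / (q : ℂ)) ^ Fintype.card ι = ((((1 : ℝ) / q) ^ Fintype.card ι : ℝ) : ℂ) := by
      push_cast
      rfl
    rw [this, Complex.ofReal_re]
  rw [hval] at hre
  refine hre.congr fun n => ?_
  simp only [Function.comp]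
  rw [← hrep, Complex.ofReal_re]

lemma card_allEdges (n : ℕ) : #(allEdges n) = n.choose 2 := by
  have h := SimpleGraph.card_edgeFinset_top_eq_card_choose_two (V := Fin n)
  rw [Fintype.card_fin] at h
  rw [← h]
  congr 1
  ext e
  simp [allEdges]

lemma sum_erWeight (n : ℕ) (p : ℝ) (P : Finset (Sym2 (Fin n)) → Prop) :
    ∑ G ∈ univ.filter (fun G : SimpleGraph (Fin n) => P G.edgeFinset), erWeight n p G =
      ∑ S ∈ (allEdges n).powerset with P S, subsetWt (allEdges n) p S := by
  refine sum_bij (fun G _ => G.edgeFinset) ?_ ?_ ?_ ?_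
  · intro G hG
    rw [mem_filter] at *
    refine ⟨?_, hG.2⟩
    rw [mem_powerset]
    intro e he
    rw [allEdges, mem_filter]
    exact ⟨mem_univ _, SimpleGraph.not_isDiag_of_mem_edgeFinset he⟩
  · intro G _ G' _ h
    exact SimpleGraph.edgeFinset_inj.1 h
  · intro S hS
    rw [mem_filter, mem_powerset] at hS
    have h1 : ∀ inst : Fintype (SimpleGraph.fromEdgeSet (S : Set (Sym2 (Fin n)))).edgeSet,
        @SimpleGraph.edgeFinset _ (SimpleGraph.fromEdgeSet (S : Set (Sym2 (Fin n)))) inst = S := by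
      intro inst
      ext e
      rw [SimpleGraph.mem_edgeFinset, SimpleGraph.edgeSet_fromEdgeSet]
      constructor
      · intro h
        exact h.1
      · intro h
        have := hS.1 h
        rw [allEdges, mem_filter] at this
        exact ⟨h, this.2⟩
    refine ⟨SimpleGraph.fromEdgeSet (S : Set (Sym2 (Fin n))), ?_, h1 _⟩
    rw [mem_filter]
    refine ⟨mem_univ _, ?_⟩
    rw [h1 _]
    exact hS.2
  · intro G _
    unfold erWeight subsetWt
    rw [card_allEdges, ← SimpleGraph.coe_edgeFinset, Set.ncard_coe_finset]

lemma density_of_lt {v : ℕ} (H : SimpleGraph (Fin v)) (m α : ℝ) (hα : 0 < α)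
    (hm : IsGreatest {x : ℝ | ∃ H' : H.Subgraph, H'.verts.Nonempty ∧
        x = (H'.edgeSet.ncard : ℝ) / (H'.verts.ncard : ℝ)} m) (hlt : m < 1 / α)
    (W : Finset (Fin v)) (hW : W.Nonempty) :
    α * #(H.edgeFinset.filter (fun e => ∀ x ∈ e, x ∈ W)) < #W := by
  set H' : H.Subgraph := (⊤ : H.Subgraph).induce (W : Set (Fin v)) with hH'
  have h1 : (H'.edgeSet.ncard : ℝ) / (H'.verts.ncard : ℝ) ≤ m :=
    hm.2 ⟨H', by simpa [hH'] using hW, rfl⟩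
  have hverts : H'.verts.ncard = #W := by
    rw [hH', SimpleGraph.Subgraph.induce_verts, Set.ncard_coe_finset]
  have hedges : #(H.edgeFinset.filter (fun e => ∀ x ∈ e, x ∈ W)) ≤ H'.edgeSet.ncard := by
    rw [← Set.ncard_coe_finset]
    refine Set.ncard_le_ncard ?_ (Set.toFinite _)
    intro e he
    rw [mem_coe, mem_filter] at he
    obtain ⟨he, h⟩ := he
    rw [SimpleGraph.mem_edgeFinset] at he
    induction e using Sym2.ind with
    | _ a b =>
      rw [SimpleGraph.Subgraph.mem_edgeSet, hH', SimpleGraph.Subgraph.induce_adj]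
      exact ⟨h a (Sym2.mem_mk_left a b), h b (Sym2.mem_mk_right a b), he⟩
  rw [hverts] at h1
  have hWpos : (0 : ℝ) < #W := by exact_mod_cast card_pos.2 hW
  have h2 := lt_of_le_of_lt h1 hlt
  rw [div_lt_div_iff₀ hWpos hα] at h2
  have h3 : (#(H.edgeFinset.filter (fun e => ∀ x ∈ e, x ∈ W)) : ℝ) ≤ H'.edgeSet.ncard := by
    exact_mod_cast hedges
  nlinarith

lemma absent_of_gt {v : ℕ} (H : SimpleGraph (Fin v)) (m α : ℝ) (hα : 0 < α)
    (hirr : Irrational α)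
    (hm : IsGreatest {x : ℝ | ∃ H' : H.Subgraph, H'.verts.Nonempty ∧
        x = (H'.edgeSet.ncard : ℝ) / (H'.verts.ncard : ℝ)} m) (hlt : ¬ m < 1 / α) :
    Tendsto (fun n : ℕ => ∑ S ∈ (allEdges n).powerset with copyNum n H S ≠ 0,
      subsetWt (allEdges n) ((n : ℝ) ^ (-α)) S) atTop (nhds 0) := by
  obtain ⟨H', hne, hmeq⟩ := hm.1
  have hvpos : 0 < H'.verts.ncard := hne.ncard_pos (Set.toFinite _)
  have hvpos' : (0 : ℝ) < H'.verts.ncard := by exact_mod_cast hvpos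
  have hgt : 1 / α < m := by
    refine lt_of_le_of_ne (not_lt.1 hlt) ?_
    intro h
    apply hirr
    refine ⟨(H'.verts.ncard : ℚ) / H'.edgeSet.ncard, ?_⟩
    push_cast
    rw [hmeq] at h
    have := congrArg (fun x : ℝ => x⁻¹) h
    simp only [one_div, inv_inv, inv_div] at this
    exact this.symm
  rw [hmeq, div_lt_div_iff₀ hα hvpos', one_mul] at hgt
  have hcardD : #H'.coe.edgeFinset = H'.edgeSet.ncard := by
    rw [← SimpleGraph.Subgraph.image_coe_edgeSet_coe,
      Set.ncard_image_of_injective _ (Sym2.map.injective Subtype.val_injective),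
      ← SimpleGraph.coe_edgeFinset, Set.ncard_coe_finset]
  have hcardV : Fintype.card H'.verts = H'.verts.ncard := by
    rw [← Nat.card_eq_fintype_card, Nat.card_coe_set_eq]
  have hfm := first_moment H'.coe.edgeFinset
    (fun e he => SimpleGraph.not_isDiag_of_mem_edgeFinset he) α hα
    (by rw [hcardD, hcardV]; linarith)
  refine squeeze_zero' ?_ ?_ hfm
  · filter_upwards [eventually_ge_atTop 1] with n hn
    exact sum_nonneg fun T _ => subsetWt_nonneg _ (by positivity)
      (Real.rpow_le_one_of_one_le_of_nonpos (by exact_mod_cast hn) (by linarith)) _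
  · filter_upwards [eventually_ge_atTop 1] with n hn
    refine sum_le_sum_of_subset_of_nonneg ?_ fun T _ _ => subsetWt_nonneg _ (by positivity)
      (Real.rpow_le_one_of_one_le_of_nonpos (by exact_mod_cast hn) (by linarith)) _
    intro S hS
    rw [mem_filter] at *
    refine ⟨hS.1, ?_⟩
    have h1 := hS.2
    unfold copyNum at h1
    obtain ⟨K, hK⟩ := card_pos.1 (Nat.pos_of_ne_zero h1)
    rw [mem_filter, copyEdges, mem_image] at hK
    obtain ⟨⟨ψ, -, rfl⟩, hK⟩ := hK
    refine ⟨(Function.Embedding.subtype _).trans ψ, ?_⟩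
    intro b hb
    rw [mem_image] at hb
    obtain ⟨e, he, rfl⟩ := hb
    apply hK
    rw [mem_image]
    refine ⟨Sym2.map Subtype.val e, ?_, ?_⟩
    · rw [SimpleGraph.mem_edgeFinset] at he ⊢
      apply H'.edgeSet_subset
      rw [← SimpleGraph.Subgraph.image_coe_edgeSet_coe]
      exact ⟨e, he, rfl⟩
    · rw [Sym2.map_map]
      rfl


lemma prob_nonneg (n : ℕ) (hn : 1 ≤ n) (α : ℝ) (hα : 0 < α) (S : Finset (Sym2 (Fin n))) :
    0 ≤ subsetWt (allEdges n) ((n : ℝ) ^ (-α)) S :=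
  subsetWt_nonneg _ (by positivity)
    (Real.rpow_le_one_of_one_le_of_nonpos (by exact_mod_cast hn) (by linarith)) _

/-- **Corollary 1.3.**  Let `q > 1`, `G₁, …, G_k` pairwise nonisomorphic connected graphs each
with at least two vertices, `α > 0` irrational, `p = n^{−α}`, `I = {i : m(G_i) < 1/α}` and
`J = [k] ∖ I`.  With `ξ_i` the number of copies of `G_i` in `G(n,p)` mod `q`, for every
`a ∈ (ℤ/qℤ)^k`, `Pr(ξ = a) → q^{−|I|}` if `a_j = 0` for all `j ∈ J`, and `Pr(ξ = a) → 0`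
otherwise. -/
theorem modular_limit_irrational_exponent
    (q : ℕ) (hq : 1 < q) (k : ℕ) (nv : Fin k → ℕ) (h2 : ∀ i, 2 ≤ nv i)
    (G : ∀ i : Fin k, SimpleGraph (Fin (nv i)))
    (hconn : ∀ i, (G i).Connected)
    (hnoniso : ∀ i j, i ≠ j → IsEmpty ((G i) ≃g (G j)))
    (α : ℝ) (hα : 0 < α) (hirr : Irrational α)
    (m : Fin k → ℝ)
    (hm : ∀ i, IsGreatest {x : ℝ | ∃ H' : (G i).Subgraph, H'.verts.Nonempty ∧
        x = (H'.edgeSet.ncard : ℝ) / (H'.verts.ncard : ℝ)} (m i))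
    (a : Fin k → ZMod q) :
    Tendsto
      (fun n : ℕ => ∑ G'' ∈ univ.filter (fun G'' : SimpleGraph (Fin n) =>
          ∀ i, ((copyCount G'' (G i) : ZMod q)) = a i),
        erWeight n ((n : ℝ) ^ (-α)) G'')
      atTop
      (nhds (if ∀ j, ¬ (m j < 1 / α) → a j = 0
        then ((1 : ℝ) / q) ^ (univ.filter (fun i => m i < 1 / α)).card
        else 0)) := by
  have : NeZero q := ⟨by omega⟩
  have hrw : ∀ n : ℕ, ∑ G'' ∈ univ.filter (fun G'' : SimpleGraph (Fin n) =>
          ∀ i, ((copyCount G'' (G i) : ZMod q)) = a i),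
        erWeight n ((n : ℝ) ^ (-α)) G'' =
      ∑ S ∈ (allEdges n).powerset with ∀ i, (copyNum n (G i) S : ZMod q) = a i,
        subsetWt (allEdges n) ((n : ℝ) ^ (-α)) S := by
    intro n
    have hs := sum_erWeight n ((n : ℝ) ^ (-α))
      (fun S => ∀ i, (copyNum n (G i) S : ZMod q) = a i)
    have e1 : univ.filter (fun G'' : SimpleGraph (Fin n) =>
          ∀ i, ((copyCount G'' (G i) : ZMod q)) = a i) =
        univ.filter (fun G'' : SimpleGraph (Fin n) =>
          (fun S => ∀ i, (copyNum n (G i) S : ZMod q) = a i) G''.edgeFinset) := by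
      ext G''
      simp only [mem_filter, mem_univ, true_and]
      refine forall_congr' fun i => ?_
      rw [copyCount_eq (h2 i) (G i) (hconn i) G'']
    rw [e1]
    convert hs using 2
    · ext G''
      simp only [mem_filter]
    · ext S
      simp only [mem_filter]
  simp only [hrw]
  have habs : ∀ j, ¬ m j < 1 / α →
      Tendsto (fun n : ℕ => ∑ S ∈ (allEdges n).powerset with copyNum n (G j) S ≠ 0,
        subsetWt (allEdges n) ((n : ℝ) ^ (-α)) S) atTop (nhds 0) :=
    fun j hj => absent_of_gt (G j) (m j) α hα hirr (hm j) hj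
  split_ifs with hJ
  · have hU := uniform_limit (q := q) (ι := {i : Fin k // m i < 1 / α}) (fun i => nv i.1)
      (fun i => h2 i.1) (fun i => G i.1) (fun i => hconn i.1)
      (fun i j hij => hnoniso i.1 j.1 (fun h => hij (Subtype.ext h))) α hα
      (fun i W hW => density_of_lt (G i.1) (m i.1) α hα (hm i.1) i.2 W hW) (fun i => a i.1)
    have hcard : Fintype.card {i : Fin k // m i < 1 / α} =
        (univ.filter (fun i => m i < 1 / α)).card := Fintype.card_subtype _
    rw [hcard] at hU
    have hB : Tendsto (fun n : ℕ => ∑ j ∈ univ.filter (fun j => ¬ m j < 1 / α),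
        ∑ S ∈ (allEdges n).powerset with copyNum n (G j) S ≠ 0,
        subsetWt (allEdges n) ((n : ℝ) ^ (-α)) S) atTop (nhds 0) := by
      have := tendsto_finsetSum (univ.filter (fun j => ¬ m j < 1 / α))
        (fun j hj => habs j (mem_filter.1 hj).2)
      simpa only [sum_const_zero] using this
    have hL := hU.sub hB
    rw [sub_zero] at hL
    refine tendsto_of_tendsto_of_tendsto_of_le_of_le' hL hU ?_ ?_
    · filter_upwards [eventually_ge_atTop 1] with n hn
      rw [sub_le_iff_le_add]
      simp only [sum_filter (s := (allEdges n).powerset)]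
      rw [sum_comm, ← sum_add_distrib]
      refine sum_le_sum fun S _ => ?_
      have hw := prob_nonneg n hn α hα S
      have hnn : ∀ j ∈ univ.filter (fun j => ¬ m j < 1 / α),
          0 ≤ (if copyNum n (G j) S ≠ 0 then
            subsetWt (allEdges n) ((n : ℝ) ^ (-α)) S else 0) := by
        intro j _
        split_ifs
        · exact hw
        · exact le_rfl
      by_cases hA : ∀ i, (copyNum n (G i) S : ZMod q) = a i
      · have hA' : ∀ i : {i : Fin k // m i < 1 / α}, (copyNum n (G i.1) S : ZMod q) = a i.1 :=
          fun i => hA i.1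
        rw [if_pos hA, if_pos hA']
        have := sum_nonneg hnn
        linarith
      · rw [if_neg hA, zero_add]
        split_ifs with hI
        · push Not at hA
          obtain ⟨j, hj⟩ := hA
          have hjI : ¬ m j < 1 / α := fun h => hj (hI ⟨j, h⟩)
          have hne : copyNum n (G j) S ≠ 0 := by
            intro h
            apply hj
            rw [h, hJ j hjI, Nat.cast_zero]
          have := single_le_sum hnn (mem_filter.2 ⟨mem_univ j, hjI⟩)
          rw [if_pos hne] at this
          exact this
        · exact sum_nonneg hnn
    · filter_upwards [eventually_ge_atTop 1] with n hn
      refine sum_le_sum_of_subset_of_nonneg ?_ fun S _ _ => prob_nonneg n hn α hα S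
      intro S hS
      rw [mem_filter] at *
      exact ⟨hS.1, fun i => hS.2 i.1⟩
  · push Not at hJ
    obtain ⟨j, hj, haj⟩ := hJ
    refine squeeze_zero' ?_ ?_ (habs j (not_lt.2 hj))
    · filter_upwards [eventually_ge_atTop 1] with n hn
      exact sum_nonneg fun S _ => prob_nonneg n hn α hα S
    · filter_upwards [eventually_ge_atTop 1] with n hn
      refine sum_le_sum_of_subset_of_nonneg ?_ fun S _ _ => prob_nonneg n hn α hα S
      intro S hS
      rw [mem_filter] at *
      refine ⟨hS.1, fun h => haj ?_⟩
      rw [← hS.2 j, h, Nat.cast_zero]
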